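/- arXiv:1508.02796 — 11 statements merged into one kernel-verified Lean document; each statement's English description precedes it below -/
import Mathlib

section
/- Let X be a symmetric positive definite n×n real matrix, ṽ ∈ ℝⁿ, and for each i = 1,…,n let f_i : ℝ → ℝ be continuous, non-increasing, and take values in [q_i^min, q_i^max]. Then there exists exactly one point q* ∈ ℝⁿ such that q*_i = f_i((Xq* + ṽ)_i) for every i; i.e., the non-incremental volt/var dynamics q(t+1) = f(Xq(t) + ṽ) has a unique equilibrium. -/
open Matrix

lemma aux_coer (n : ℕ) (hn : 1 ≤ n) (X : Matrix (Fin n) (Fin n) ℝ)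
    (hpos : ∀ x : Fin n → ℝ, x ≠ 0 → 0 < x ⬝ᵥ (X *ᵥ x)) :
    ∃ c > 0, ∀ x : Fin n → ℝ, c * ‖x‖ ^ 2 ≤ x ⬝ᵥ (X *ᵥ x) := by
  haveI : Nonempty (Fin n) := ⟨⟨0, hn⟩⟩
  have hcont : Continuous (fun x : Fin n → ℝ => x ⬝ᵥ (X *ᵥ x)) := by fun_prop
  have hne : (Metric.sphere (0 : Fin n → ℝ) 1).Nonempty :=
    NormedSpace.sphere_nonempty.2 zero_le_one
  obtain ⟨y, hy, hmin⟩ := (isCompact_sphere (0 : Fin n → ℝ) 1).exists_isMinOn hne hcont.continuousOn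
  have hy1 : ‖y‖ = 1 := by simpa using hy
  refine ⟨_, hpos y (by rintro rfl; simp at hy1), fun x => ?_⟩
  by_cases hx : x = 0
  · subst hx; simp
  have hx' : 0 < ‖x‖ := norm_pos_iff.2 hx
  have h := hmin (show (‖x‖⁻¹ • x) ∈ Metric.sphere (0 : Fin n → ℝ) 1 by
    simp [norm_smul, hx'.ne'])
  simp only [Set.mem_ofPred_eq, mulVec_smul, dotProduct_smul, smul_dotProduct, smul_eq_mul] at h
  calc _ ≤ (‖x‖⁻¹ * (‖x‖⁻¹ * (x ⬝ᵥ X *ᵥ x))) * ‖x‖ ^ 2 := by gcongr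
    _ = _ := by field_simp

/-- Existence and uniqueness of the equilibrium of the non-incremental
volt/var dynamics `q(t+1) = f(X q(t) + ṽ)`. -/
theorem stmt_0 (n : ℕ) (hn : 1 ≤ n)
    (X : Matrix (Fin n) (Fin n) ℝ) (hXsym : X.IsSymm) (hXpd : X.PosDef)
    (vtil : Fin n → ℝ)
    (qmin qmax : Fin n → ℝ) (hmin : ∀ i, qmin i ≤ 0) (hmax : ∀ i, 0 ≤ qmax i)
    (f : Fin n → ℝ → ℝ)
    (hf_cont : ∀ i, Continuous (f i))
    (hf_anti : ∀ i, Antitone (f i))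
    (hf_range : ∀ i x, f i x ∈ Set.Icc (qmin i) (qmax i)) :
    ∃! q : Fin n → ℝ, ∀ i, q i = f i ((X.mulVec q + vtil) i) := by
  have hpos : ∀ x : Fin n → ℝ, x ≠ 0 → 0 < x ⬝ᵥ (X *ᵥ x) := by
    intro x hx
    simpa using hXpd.dotProduct_mulVec_pos hx
  have hsymm : ∀ x y : Fin n → ℝ, x ⬝ᵥ (X *ᵥ y) = y ⬝ᵥ (X *ᵥ x) := by
    intro x y
    rw [dotProduct_mulVec, ← mulVec_transpose, hXsym.eq, dotProduct_comm]
  obtain ⟨c, hc, hcoer⟩ := aux_coer n hn X hpos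
  apply existsUnique_of_exists_of_unique
  · let F : Fin n → ℝ → ℝ := fun i s => ∫ t in (0:ℝ)..s, f i t
    have hF : ∀ i s, HasDerivAt (F i) (f i s) s := fun i s =>
      intervalIntegral.integral_hasDerivAt_right ((hf_cont i).intervalIntegrable _ _)
        ((hf_cont i).stronglyMeasurableAtFilter _ _) (hf_cont i).continuousAt
    have hFc : ∀ i, Continuous (F i) := fun i =>
      continuous_iff_continuousAt.2 fun s => (hF i s).continuousAt
    have hFb : ∀ i s, F i s ≤ (qmax i - qmin i) * |s| := by
      intro i s
      have := intervalIntegral.norm_integral_le_of_norm_le_const (a := 0) (b := s)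
        (f := f i) (C := qmax i - qmin i) (by
          intro t _
          have h1 := (hf_range i t).1
          have h2 := (hf_range i t).2
          have := hmin i
          have := hmax i
          rw [Real.norm_eq_abs, abs_le]; constructor <;> linarith)
      rw [sub_zero, Real.norm_eq_abs] at this
      exact (le_abs_self _).trans this
    let G : (Fin n → ℝ) → ℝ := fun q =>
      (1/2) * (q ⬝ᵥ (X *ᵥ q)) - ∑ i, F i ((X *ᵥ q) i + vtil i)
    have hGc : Continuous G := by
      have h1 : Continuous (fun q : Fin n → ℝ => X *ᵥ q) := by fun_prop
      refine Continuous.sub (by fun_prop) (continuous_finsetSum _ fun i _ => ?_)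
      exact (hFc i).comp (((continuous_apply i).comp h1).add continuous_const)
    let A := ‖(LinearMap.toContinuousLinearMap (Matrix.mulVecLin X))‖
    have hA : ∀ q : Fin n → ℝ, ‖X *ᵥ q‖ ≤ A * ‖q‖ := fun q =>
      (LinearMap.toContinuousLinearMap (Matrix.mulVecLin X)).le_opNorm q
    let B := ∑ i, (qmax i - qmin i)
    have hlow : ∀ q, c/2 * ‖q‖^2 - B * (A * ‖q‖ + ‖vtil‖) ≤ G q := by
      intro q
      have h1 := hcoer q
      have h2 : ∑ i, F i ((X *ᵥ q) i + vtil i) ≤ B * (A * ‖q‖ + ‖vtil‖) := by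
        rw [Finset.sum_mul]
        refine Finset.sum_le_sum fun i _ => (hFb i _).trans ?_
        have : 0 ≤ qmax i - qmin i := by linarith [hmin i, hmax i]
        gcongr
        have h3 := norm_le_pi_norm (X *ᵥ q) i
        have h4 := norm_le_pi_norm vtil i
        have h5 := abs_add_le ((X *ᵥ q) i) (vtil i)
        rw [Real.norm_eq_abs] at h3 h4
        linarith [hA q]
      simp only [G]
      linarith
    obtain ⟨q, hq⟩ := hGc.exists_forall_le' 0 (by
      filter_upwards [(tendsto_norm_cocompact_atTop (E := Fin n → ℝ)).eventually
        (Filter.eventually_ge_atTop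
          (max 1 (2 * (B * A + |B * ‖vtil‖| + |G 0|) / c)))] with x hx
      have h1 : 1 ≤ ‖x‖ := (le_max_left _ _).trans hx
      have h2 := (le_max_right _ _).trans hx
      rw [div_le_iff₀ hc] at h2
      have h3 := hlow x
      have h4 := le_abs_self (B * ‖vtil‖)
      have h5 := le_abs_self (G 0)
      have h6 := mul_le_mul_of_nonneg_right h2 (norm_nonneg x)
      have h7 := mul_le_mul_of_nonneg_left h1 (abs_nonneg (B * ‖vtil‖))
      have h8 := mul_le_mul_of_nonneg_left h1 (abs_nonneg (G 0))
      nlinarith)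
    refine ⟨q, ?_⟩
    let g : Fin n → ℝ := fun i => f i ((X *ᵥ q) i + vtil i)
    let d := q - g
    have hline : ∀ t : ℝ, G (q + t • d) = (1/2) * (q ⬝ᵥ (X *ᵥ q) + t * (2 * (d ⬝ᵥ (X *ᵥ q)))
        + t^2 * (d ⬝ᵥ (X *ᵥ d))) - ∑ i, F i (((X *ᵥ q) i + vtil i) + t * (X *ᵥ d) i) := by
      intro t
      simp only [G]
      congr 1
      · simp only [mulVec_add, mulVec_smul, dotProduct_add, add_dotProduct, dotProduct_smul,
          smul_dotProduct, smul_eq_mul]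
        rw [hsymm q d]; ring
      · refine Finset.sum_congr rfl fun i _ => ?_
        congr 1
        simp only [mulVec_add, mulVec_smul, Pi.add_apply, Pi.smul_apply, smul_eq_mul]
        ring
    have hder : HasDerivAt (fun t : ℝ => G (q + t • d))
        (d ⬝ᵥ (X *ᵥ q) - ∑ i, g i * (X *ᵥ d) i) 0 := by
      rw [funext hline]
      refine HasDerivAt.sub ?_ (HasDerivAt.fun_sum fun i _ => ?_)
      · have h := ((((hasDerivAt_id (0:ℝ)).mul_const (2 * (d ⬝ᵥ (X *ᵥ q)))).const_add
          (q ⬝ᵥ (X *ᵥ q))).add (((hasDerivAt_id (0:ℝ)).pow 2).mul_const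
            (d ⬝ᵥ (X *ᵥ d)))).const_mul (1/2)
        refine h.congr_deriv ?_
        simp
      · have h := ((hasDerivAt_id (0:ℝ)).mul_const ((X *ᵥ d) i)).const_add
          ((X *ᵥ q) i + vtil i)
        have h2 := HasDerivAt.comp (0:ℝ) (hF i _) h
        refine h2.congr_deriv ?_
        simp [g]
    have hz := IsLocalMin.hasDerivAt_eq_zero
      (Filter.Eventually.of_forall fun t => by simpa using hq (q + t • d)) hder
    have hd : d = 0 := by
      by_contra hne
      have h1 := hpos d hne
      have h2 : d ⬝ᵥ (X *ᵥ d) = d ⬝ᵥ (X *ᵥ q) - g ⬝ᵥ (X *ᵥ d) := by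
        rw [hsymm g d, ← dotProduct_sub, ← mulVec_sub]
      have h3 : g ⬝ᵥ (X *ᵥ d) = ∑ i, g i * (X *ᵥ d) i := rfl
      linarith
    intro i
    have := congrFun (sub_eq_zero.1 hd) i
    simpa [g] using this
  · intro p q hp hq
    by_contra hne
    have h1 := hpos (p - q) (sub_ne_zero.2 hne)
    have h2 : (p - q) ⬝ᵥ (X *ᵥ (p - q)) ≤ 0 := by
      refine Finset.sum_nonpos fun i _ => ?_
      rw [mulVec_sub, Pi.sub_apply, Pi.sub_apply, hp i, hq i, Pi.add_apply, Pi.add_apply]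
      rcases le_total ((X *ᵥ p) i) ((X *ᵥ q) i) with h | h
      · exact mul_nonpos_of_nonneg_of_nonpos
          (sub_nonneg.2 (hf_anti i (by linarith))) (by linarith)
      · exact mul_nonpos_of_nonpos_of_nonneg
          (sub_nonpos.2 (hf_anti i (by linarith))) (by linarith)
    linarith
end

section
/- Let X be a symmetric positive definite n×n real matrix, ṽ ∈ ℝⁿ. For each i let g_i : ℝ → ℝ be a continuous strictly decreasing bijection, f_i(v) = min(q_i^max, max(q_i^min, g_i(v))), C_i(q) = −∫₀^q g_i⁻¹(s) ds, C(q) = Σ_i C_i(q_i), and F(q) = C(q) + ½ qᵀXq + qᵀṽ. Then a point q* ∈ Ω satisfies q*_i = f_i((Xq* + ṽ)_i) for all i if and only if q* is the (unique) minimizer of F over Ω = ∏_i [q_i^min, q_i^max]. -/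
open Matrix

lemma aux_cont (h : ℝ → ℝ) (ha : Antitone h) (hs : Function.Surjective h) : Continuous h := by
  have h1 : Monotone (fun x => - h x) := fun a b hab => neg_le_neg (ha hab)
  have h2 : Function.Surjective (fun x => - h x) := by
    intro y
    obtain ⟨x, hx⟩ := hs (-y)
    exact ⟨x, by simp [hx]⟩
  have h3 := (h1.continuous_of_surjective h2).neg
  have h4 : (fun x => - (- h x)) = h := by
    funext x
    simp
  rwa [← h4]

lemma aux_int (h : ℝ → ℝ) (ha : Antitone h) (hc : Continuous h) (a b : ℝ) :
    h b * (b - a) ≤ ∫ s in a..b, h s ∧ ∫ s in a..b, h s ≤ h a * (b - a) := by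
  have key : ∀ a b : ℝ, a ≤ b → h b * (b - a) ≤ ∫ s in a..b, h s ∧ 
      ∫ s in a..b, h s ≤ h a * (b - a) := by
    intro a b hab
    constructor
    · have := intervalIntegral.integral_mono_on (μ := MeasureTheory.volume) hab
        intervalIntegrable_const (hc.intervalIntegrable a b)
        (fun x hx => ha hx.2)
      simpa [mul_comm] using this
    · have := intervalIntegral.integral_mono_on (μ := MeasureTheory.volume) hab
        (hc.intervalIntegrable a b) intervalIntegrable_const
        (fun x hx => ha hx.1)
      simpa [mul_comm] using this
  rcases le_total a b with hab | hab
  · exact key a b hab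
  · have := key b a hab
    rw [intervalIntegral.integral_symm]
    constructor <;> nlinarith [this.1, this.2]

lemma aux_quad {n : ℕ} (X : Matrix (Fin n) (Fin n) ℝ) (hX : X.IsSymm) (p q : Fin n → ℝ) :
    (1/2) * (p ⬝ᵥ X.mulVec p) - (1/2) * (q ⬝ᵥ X.mulVec q) =
      (p - q) ⬝ᵥ X.mulVec q + (1/2) * ((p - q) ⬝ᵥ X.mulVec (p - q)) := by
  have h : p ⬝ᵥ X.mulVec q = q ⬝ᵥ X.mulVec p := by
    rw [Matrix.dotProduct_mulVec, ← Matrix.mulVec_transpose, hX.eq, dotProduct_comm]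
  simp only [Matrix.mulVec_sub, sub_dotProduct, dotProduct_sub]
  linarith

/-- A point `q* ∈ Ω` is a fixed point of the non-incremental volt/var control,
`q*_i = f_i((Xq* + ṽ)_i)` for all `i`, if and only if `q*` is the (unique)
minimizer of `F` over `Ω`. -/
theorem stmt_2 (n : ℕ) (hn : 1 ≤ n)
    (X : Matrix (Fin n) (Fin n) ℝ) (hXsym : X.IsSymm) (hXpd : X.PosDef)
    (vtil : Fin n → ℝ)
    (qmin qmax : Fin n → ℝ) (hmin : ∀ i, qmin i ≤ 0) (hmax : ∀ i, 0 ≤ qmax i)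
    (g ginv : Fin n → ℝ → ℝ)
    (hg_cont : ∀ i, Continuous (g i))
    (hg_anti : ∀ i, StrictAnti (g i))
    (hg_bij : ∀ i, Function.Bijective (g i))
    (hginv : ∀ i, Function.LeftInverse (ginv i) (g i) ∧ Function.RightInverse (ginv i) (g i))
    (f : Fin n → ℝ → ℝ)
    (hf : ∀ i v, f i v = min (qmax i) (max (qmin i) (g i v)))
    (C : Fin n → ℝ → ℝ)
    (hC : ∀ i q, C i q = -∫ s in (0:ℝ)..q, ginv i s)
    (F : (Fin n → ℝ) → ℝ)
    (hF : ∀ q, F q = (∑ i, C i (q i)) + (1/2) * (q ⬝ᵥ X.mulVec q) + q ⬝ᵥ vtil)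
    (Ω : Set (Fin n → ℝ))
    (hΩ : Ω = Set.univ.pi fun i => Set.Icc (qmin i) (qmax i)) :
    (∃! p, p ∈ Ω ∧ IsMinOn F Ω p) ∧
    (∀ q ∈ Ω, ((∀ i, q i = f i ((X.mulVec q + vtil) i)) ↔ IsMinOn F Ω q)) := by
  have hga : ∀ i, Antitone (ginv i) := by
    intro i a b hab
    by_contra hc
    push Not at hc
    have := hg_anti i hc
    rw [(hginv i).2 a, (hginv i).2 b] at this
    linarith
  have hgc : ∀ i, Continuous (ginv i) := fun i =>
    aux_cont _ (hga i) (hginv i).1.surjective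
  have hCd : ∀ i a b, C i b - C i a = -∫ s in a..b, ginv i s := by
    intro i a b
    rw [hC, hC, ← intervalIntegral.integral_add_adjacent_intervals
      ((hgc i).intervalIntegrable 0 a) ((hgc i).intervalIntegrable a b)]
    ring
  have hFd : ∀ p q, F p - F q = (∑ i, ((C i (p i) - C i (q i)) +
      (p i - q i) * (X.mulVec q + vtil) i)) + (1/2) * ((p - q) ⬝ᵥ X.mulVec (p - q)) := by
    intro p q
    have h1 := aux_quad X hXsym p q
    have h2 : ∑ i, (p i - q i) * (X.mulVec q + vtil) i
        = (p - q) ⬝ᵥ X.mulVec q + (p ⬝ᵥ vtil - q ⬝ᵥ vtil) := by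
      rw [← sub_dotProduct, ← dotProduct_add]
      rfl
    rw [hF, hF, Finset.sum_add_distrib, Finset.sum_sub_distrib, h2]
    linarith
  have hmem : ∀ q, q ∈ Ω ↔ ∀ i, qmin i ≤ q i ∧ q i ≤ qmax i := by
    intro q
    simp only [hΩ, Set.mem_pi, Set.mem_univ, true_imp_iff, Set.mem_Icc]
  have hlow : ∀ q ∈ Ω, (∀ i, q i = f i ((X.mulVec q + vtil) i)) → ∀ p ∈ Ω,
      (1/2) * ((p - q) ⬝ᵥ X.mulVec (p - q)) ≤ F p - F q := by
    intro q hq hfix p hp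
    rw [hFd p q]
    have : 0 ≤ ∑ i, ((C i (p i) - C i (q i)) + (p i - q i) * (X.mulVec q + vtil) i) := by
      apply Finset.sum_nonneg
      intro i _
      rw [hCd]
      have hi := (aux_int (ginv i) (hga i) (hgc i) (q i) (p i)).2
      have hqi := (hmem q).1 hq i
      have hpi := (hmem p).1 hp i
      have hfi := hfix i
      rw [hf] at hfi
      set w := (X.mulVec q + vtil) i
      have hw := (hginv i).1 w
      suffices 0 ≤ (p i - q i) * (w - ginv i (q i)) by nlinarith
      rcases le_total (p i) (q i) with h | h
      · rcases eq_or_lt_of_le h with h | h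
        · simp [h]
        · have : q i ≤ g i w := by
            by_contra hc
            push Not at hc
            have h5 : max (qmin i) (g i w) < q i := max_lt (by linarith) hc
            have := min_le_right (qmax i) (max (qmin i) (g i w))
            linarith
          have := hga i this
          rw [hw] at this
          nlinarith
      · rcases eq_or_lt_of_le h with h | h
        · simp [h]
        · have : g i w ≤ q i := by
            by_contra hc
            push Not at hc
            have : q i < min (qmax i) (max (qmin i) (g i w)) :=
              lt_min (by linarith) (lt_max_of_lt_right hc)
            linarith
          have := hga i this
          rw [hw] at this
          nlinarith
    linarith
  have hfwd : ∀ q ∈ Ω, (∀ i, q i = f i ((X.mulVec q + vtil) i)) → IsMinOn F Ω q := by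
    intro q hq hfix
    rw [isMinOn_iff]
    intro p hp
    have h1 := hlow q hq hfix p hp
    have h2 := hXpd.posSemidef.dotProduct_mulVec_nonneg (p - q)
    simp only [star_trivial] at h2
    linarith
  have hbwd : ∀ q ∈ Ω, IsMinOn F Ω q → ∀ i, q i = f i ((X.mulVec q + vtil) i) := by
    intro q hq hm i
    rw [isMinOn_iff] at hm
    have hqi := (hmem q).1 hq i
    have key : ∀ s, qmin i ≤ s → s ≤ qmax i →
        0 ≤ (s - q i) * (-ginv i s + (X.mulVec q + vtil) i + (1/2) * X i i * (s - q i)) := by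
      intro s hs1 hs2
      have hp : Function.update q i s ∈ Ω := by
        rw [hmem]
        intro j
        by_cases hj : j = i
        · subst hj
          simp [hs1, hs2]
        · simpa [hj] using (hmem q).1 hq j
      have h1 := hm _ hp
      have h2 := hFd (Function.update q i s) q
      have h3 : Function.update q i s - q = Pi.single i (s - q i) := by
        ext j
        by_cases hj : j = i
        · subst hj
          simp
        · simp [hj]
      rw [h3, Finset.sum_eq_single i (by intro j _ hj; simp [hj]) (by simp), hCd] at h2
      simp only [Function.update_self, single_dotProduct, Matrix.mulVec_single, Pi.smul_apply,
        Matrix.col_apply, MulOpposite.smul_eq_mul_unop, MulOpposite.unop_op] at h2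
      have h4 := (aux_int (ginv i) (hga i) (hgc i) (q i) s).1
      nlinarith
    rw [hf]
    set w := (X.mulVec q + vtil) i
    have hw := (hginv i).2
    have hφ : Continuous (fun s => -ginv i s + w + (1/2) * X i i * (s - q i)) := by
      have := hgc i
      fun_prop
    rcases lt_trichotomy (q i) (min (qmax i) (max (qmin i) (g i w))) with h | h | h
    · exfalso
      have ha : q i < qmax i := lt_of_lt_of_le h (min_le_left _ _)
      have hb : q i < g i w := by
        rcases lt_max_iff.1 (lt_of_lt_of_le h (min_le_right _ _)) with h | h
        · linarith
        · exact h
      have hc : w < ginv i (q i) := by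
        rw [← hw (q i)] at hb
        exact (hg_anti i).lt_iff_gt.1 hb
      have hd : ∀ᶠ s in nhdsWithin (q i) (Set.Ioi (q i)),
          -ginv i s + w + (1/2) * X i i * (s - q i) < 0 := by
        apply Filter.Eventually.filter_mono nhdsWithin_le_nhds
        apply hφ.continuousAt.eventually_lt_const
        simp
        linarith
      obtain ⟨s, hs, hs2⟩ := (hd.and (Ioo_mem_nhdsGT ha)).exists
      have := key s (by linarith [hs2.1]) hs2.2.le
      nlinarith [mul_neg_of_pos_of_neg (sub_pos.2 hs2.1) hs]
    · exact h
    · exfalso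
      have ha' : max (qmin i) (g i w) < q i := by
        rcases min_lt_iff.1 h with h | h
        · linarith
        · exact h
      have ha : qmin i < q i := lt_of_le_of_lt (le_max_left _ _) ha'
      have hb : g i w < q i := lt_of_le_of_lt (le_max_right _ _) ha'
      have hc : ginv i (q i) < w := by
        rw [← hw (q i)] at hb
        exact (hg_anti i).lt_iff_gt.1 hb
      have hd : ∀ᶠ s in nhdsWithin (q i) (Set.Iio (q i)),
          0 < -ginv i s + w + (1/2) * X i i * (s - q i) := by
        apply Filter.Eventually.filter_mono nhdsWithin_le_nhds
        apply hφ.continuousAt.eventually_const_lt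
        simp
        linarith
      obtain ⟨s, hs, hs2⟩ := (hd.and (Ioo_mem_nhdsLT ha)).exists
      have := key s hs2.1.le (by linarith [hs2.2])
      nlinarith [mul_neg_of_neg_of_pos (sub_neg.2 hs2.2) hs]
  refine ⟨?_, fun q hq => ⟨hfwd q hq, hbwd q hq⟩⟩
  have hcomp : IsCompact Ω := by
    rw [hΩ]
    exact isCompact_univ_pi fun i => isCompact_Icc
  have hne : Ω.Nonempty := ⟨0, by rw [hmem]; exact fun i => ⟨hmin i, hmax i⟩⟩
  have hCc : ∀ i, Continuous (C i) := by
    intro i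
    have : C i = fun q => -∫ s in (0:ℝ)..q, ginv i s := funext (hC i)
    rw [this]
    exact (intervalIntegral.continuous_primitive
      (fun a b => (hgc i).intervalIntegrable a b) 0).neg
  have hFc : Continuous F := by
    have : F = fun q => (∑ i, C i (q i)) + (1/2) * (q ⬝ᵥ X.mulVec q) + q ⬝ᵥ vtil := funext hF
    rw [this]
    have h1 : Continuous fun q : Fin n → ℝ => ∑ i, C i (q i) :=
      continuous_finsetSum _ fun i _ => (hCc i).comp (continuous_apply i)
    have h2 : Continuous fun q : Fin n → ℝ => q ⬝ᵥ X.mulVec q :=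
      continuous_id.dotProduct (continuous_const.matrix_mulVec continuous_id)
    have h3 : Continuous fun q : Fin n → ℝ => q ⬝ᵥ vtil :=
      continuous_id.dotProduct continuous_const
    exact (h1.add (continuous_const.mul h2)).add h3
  obtain ⟨p, hp, hpm⟩ := hcomp.exists_isMinOn hne hFc.continuousOn
  refine ⟨p, ⟨hp, hpm⟩, ?_⟩
  rintro r ⟨hr, hrm⟩
  by_contra hne
  have h1 := hlow p hp (hbwd p hp hpm) r hr
  have h2 := hXpd.dotProduct_mulVec_pos (x := r - p) (sub_ne_zero.2 hne)
  simp only [star_trivial] at h2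
  have h3 := isMinOn_iff.1 hrm p hp
  linarith
end

section
/- (Theorem 1) Let X be a symmetric positive definite n×n real matrix, ṽ ∈ ℝⁿ, and for each i let g_i : ℝ → ℝ be a continuous strictly decreasing bijection, f_i(v) = min(q_i^max, max(q_i^min, g_i(v))), C_i(q) = −∫₀^q g_i⁻¹(s) ds, and F(q) = Σ_i C_i(q_i) + ½ qᵀXq + qᵀṽ. Fix any stepsize γ_p > 0 and consider the pseudo-gradient update map T(q) = clamp_Ω(q − γ_p (q − f(Xq + ṽ))). Then T has a unique fixed point q* in Ω, and a point q* ∈ Ω is a fixed point of T if and only if q* is the unique minimizer of F over Ω (equivalently, q* = f(Xq* + ṽ)). -/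
open Matrix

lemma aux_T {a b q f γ : ℝ} (hq : a ≤ q ∧ q ≤ b) (hf : a ≤ f ∧ f ≤ b) (hγ : 0 < γ) :
    max a (min b (q - γ * (q - f))) = q ↔ q = f := by
  constructor
  · intro h
    rcases lt_trichotomy q f with h1 | h1 | h1
    · have h2 : 0 < γ * (f - q) := mul_pos hγ (by linarith)
      have h3 : q < min b (q - γ * (q - f)) := lt_min (by linarith) (by linarith)
      have := le_max_right a (min b (q - γ * (q - f)))
      linarith
    · exact h1
    · have h2 : 0 < γ * (q - f) := mul_pos hγ (by linarith)
      have h3 : max a (min b (q - γ * (q - f))) < q :=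
        max_lt (by linarith) (lt_of_le_of_lt (min_le_right _ _) (by linarith))
      linarith
  · intro h
    subst h
    simp [hq.1, hq.2]

lemma aux_VI {a b q v : ℝ} {g G : ℝ → ℝ} (hG : StrictAnti G) (hGg : ∀ x, G (g x) = x)
    (hq : a ≤ q ∧ q ≤ b) :
    q = min b (max a (g v)) ↔ ∀ y, a ≤ y → y ≤ b → 0 ≤ (y - q) * (v - G q) := by
  constructor
  · intro h y hy1 hy2
    rcases lt_trichotomy q (g v) with h1 | h1 | h1
    · have h2 : q = b := by
        rcases min_choice b (max a (g v)) with h3 | h3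
        · rw [h, h3]
        · have := le_max_right a (g v)
          linarith
      have := hG h1
      rw [hGg] at this
      exact mul_nonneg_of_nonpos_of_nonpos (by linarith) (by linarith)
    · rw [h1, hGg]; simp
    · have h2 : q = a := by
        apply le_antisymm _ hq.1
        have h4 : q ≤ max a (g v) := h.le.trans (min_le_right _ _)
        rcases le_max_iff.1 h4 with h5 | h5
        · exact h5
        · linarith
      have := hG h1
      rw [hGg] at this
      exact mul_nonneg (by linarith) (by linarith)
  · intro h
    set f := min b (max a (g v)) with hf
    have hfb : f ≤ b := min_le_left _ _
    have hfa : a ≤ f := le_min (hq.1.trans hq.2) (le_max_left _ _)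
    have h0 := h f hfa hfb
    rcases lt_trichotomy q f with h1 | h1 | h1
    · have h3 : q < g v := by
        have : q < max a (g v) := lt_of_lt_of_le h1 (min_le_right _ _)
        rcases lt_max_iff.1 this with h5 | h5
        · linarith
        · exact h5
      have := hG h3
      rw [hGg] at this
      nlinarith
    · exact h1
    · have h3 : g v < q := by
        rcases min_lt_iff.1 h1 with h5 | h5
        · linarith
        · exact lt_of_le_of_lt (le_max_right _ _) h5
      have := hG h3
      rw [hGg] at this
      nlinarith

lemma aux_C {G : ℝ → ℝ} (hG : Antitone G) (x y : ℝ) :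
    ∫ s in x..y, G s ≤ (y - x) * G x := by
  have hi : ∀ a b, IntervalIntegrable G MeasureTheory.volume a b :=
    fun a b => hG.intervalIntegrable
  rcases le_total x y with h | h
  · have := intervalIntegral.integral_mono_on h (hi x y) (intervalIntegrable_const (c := G x))
      (fun s hs => hG hs.1)
    simpa using this
  · have := intervalIntegral.integral_mono_on h (intervalIntegrable_const (c := G x)) (hi y x)
      (fun s hs => hG hs.2)
    rw [intervalIntegral.integral_symm]
    simp at this
    linarith

/-- Theorem 1: the pseudo-gradient update map
`T(q) = clamp_Ω(q − γ_p (q − f(Xq + ṽ)))` has a unique fixed point in `Ω`,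
and `q* ∈ Ω` is a fixed point of `T` iff `q*` minimizes `F` over `Ω`
(equivalently, `q* = f(Xq* + ṽ)`). -/
theorem stmt_3 (n : ℕ) (hn : 1 ≤ n)
    (X : Matrix (Fin n) (Fin n) ℝ) (hXsym : X.IsSymm) (hXpd : X.PosDef)
    (vtil : Fin n → ℝ)
    (qmin qmax : Fin n → ℝ) (hmin : ∀ i, qmin i ≤ 0) (hmax : ∀ i, 0 ≤ qmax i)
    (g ginv : Fin n → ℝ → ℝ)
    (hg_cont : ∀ i, Continuous (g i))
    (hg_anti : ∀ i, StrictAnti (g i))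
    (hg_bij : ∀ i, Function.Bijective (g i))
    (hginv : ∀ i, Function.LeftInverse (ginv i) (g i) ∧ Function.RightInverse (ginv i) (g i))
    (f : Fin n → ℝ → ℝ)
    (hf : ∀ i v, f i v = min (qmax i) (max (qmin i) (g i v)))
    (C : Fin n → ℝ → ℝ)
    (hC : ∀ i q, C i q = -∫ s in (0:ℝ)..q, ginv i s)
    (F : (Fin n → ℝ) → ℝ)
    (hF : ∀ q, F q = (∑ i, C i (q i)) + (1/2) * (q ⬝ᵥ X.mulVec q) + q ⬝ᵥ vtil)
    (Ω : Set (Fin n → ℝ))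
    (hΩ : Ω = Set.univ.pi fun i => Set.Icc (qmin i) (qmax i))
    (γp : ℝ) (hγp : 0 < γp)
    (T : (Fin n → ℝ) → (Fin n → ℝ))
    (hT : ∀ q i, T q i
      = max (qmin i) (min (qmax i) (q i - γp * (q i - f i ((X.mulVec q + vtil) i))))) :
    (∃! qs, qs ∈ Ω ∧ T qs = qs) ∧
    (∀ qs ∈ Ω, (T qs = qs ↔ IsMinOn F Ω qs)) ∧
    (∀ qs ∈ Ω, (T qs = qs ↔ ∀ i, qs i = f i ((X.mulVec qs + vtil) i))) := by
  have hGg : ∀ i x, ginv i (g i x) = x := fun i => (hginv i).1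
  have hgG : ∀ i x, g i (ginv i x) = x := fun i => (hginv i).2
  have hG : ∀ i, StrictAnti (ginv i) := by
    intro i x y hxy
    rw [← (hg_anti i).lt_iff_gt, hgG, hgG]
    exact hxy
  have hGc : ∀ i, Continuous (ginv i) := by
    intro i
    have h1 : Continuous (fun x => - ginv i x) := by
      apply Monotone.continuous_of_surjective
      · intro x y hxy
        exact neg_le_neg ((hG i).antitone hxy)
      · intro y
        exact ⟨g i (-y), by simp [hGg]⟩
    have h2 := h1.neg
    have h3 : (fun x => - ginv i x) = - ginv i := rfl
    rwa [h3, neg_neg] at h2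
  have hCd : ∀ i x y, C i y - C i x = - ∫ s in x..y, ginv i s := by
    intro i x y
    rw [hC, hC, ← intervalIntegral.integral_add_adjacent_intervals
      ((hGc i).intervalIntegrable 0 x) ((hGc i).intervalIntegrable x y)]
    ring
  have hClow : ∀ i x y, -((y - x) * ginv i x) ≤ C i y - C i x := by
    intro i x y
    rw [hCd]
    exact neg_le_neg (aux_C (hG i).antitone x y)
  have hCc : ∀ i, Continuous (C i) := by
    intro i
    have : C i = fun q => -∫ s in (0:ℝ)..q, ginv i s := funext (hC i)
    rw [this]
    exact (intervalIntegral.continuous_primitive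
      (fun a b => (hGc i).intervalIntegrable a b) 0).neg
  have hFc : Continuous F := by
    have : F = fun q => (∑ i, C i (q i)) + (1/2) * (q ⬝ᵥ X.mulVec q) + q ⬝ᵥ vtil := funext hF
    rw [this]
    have h1 : Continuous fun q : Fin n → ℝ => ∑ i, C i (q i) :=
      continuous_finsetSum _ fun i _ => (hCc i).comp (continuous_apply i)
    have h2 : Continuous fun q : Fin n → ℝ => q ⬝ᵥ X.mulVec q :=
      Continuous.dotProduct continuous_id (Continuous.matrix_mulVec continuous_const continuous_id)
    have h3 : Continuous fun q : Fin n → ℝ => q ⬝ᵥ vtil :=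
      Continuous.dotProduct continuous_id continuous_const
    exact (h1.add (continuous_const.mul h2)).add h3
  have hmem : ∀ q, q ∈ Ω ↔ ∀ i, qmin i ≤ q i ∧ q i ≤ qmax i := by
    intro q; rw [hΩ]; simp only [Set.mem_pi, Set.mem_univ, true_imp_iff, Set.mem_Icc]
  have hFd : ∀ q d, F (q + d) - F q = (∑ i, (C i (q i + d i) - C i (q i)))
      + (∑ i, d i * (X.mulVec q + vtil) i) + (1/2) * (d ⬝ᵥ X.mulVec d) := by
    intro q d
    have hs : q ⬝ᵥ X.mulVec d = d ⬝ᵥ X.mulVec q := by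
      rw [Matrix.dotProduct_mulVec, ← Matrix.mulVec_transpose, hXsym.eq, dotProduct_comm]
    have h2 : (∑ i, d i * (X.mulVec q + vtil) i) = d ⬝ᵥ X.mulVec q + d ⬝ᵥ vtil := by
      rw [← dotProduct_add]; rfl
    rw [hF, hF, h2, Matrix.mulVec_add, dotProduct_add, add_dotProduct, add_dotProduct,
      add_dotProduct, hs, Finset.sum_sub_distrib]
    simp only [Pi.add_apply]
    ring
  have hA : ∀ qs ∈ Ω, (T qs = qs ↔ ∀ i, qs i = f i ((X.mulVec qs + vtil) i)) := by
    intro q hq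
    rw [funext_iff]
    refine forall_congr' fun i => ?_
    rw [hT]
    refine aux_T ((hmem q).1 hq i) ?_ hγp
    rw [hf]
    exact ⟨le_min ((hmin i).trans (hmax i)) (le_max_left _ _), min_le_left _ _⟩
  have hB : ∀ qs ∈ Ω, (T qs = qs ↔ ∀ i y, qmin i ≤ y → y ≤ qmax i →
      0 ≤ (y - qs i) * ((X.mulVec qs + vtil) i - ginv i (qs i))) := by
    intro q hq
    rw [hA q hq]
    refine forall_congr' fun i => ?_
    rw [hf]
    exact aux_VI (hG i) (hGg i) ((hmem q).1 hq i)
  have hlow : ∀ q ∈ Ω, T q = q → ∀ y ∈ Ω,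
      (1/2) * ((y - q) ⬝ᵥ X.mulVec (y - q)) ≤ F y - F q := by
    intro q hq hTq y hy
    have h1 := hFd q (y - q)
    rw [add_sub_cancel] at h1
    rw [h1, ← Finset.sum_add_distrib]
    have : 0 ≤ ∑ i, (C i (q i + (y - q) i) - C i (q i) + (y - q) i * (X.mulVec q + vtil) i) := by
      refine Finset.sum_nonneg fun i _ => ?_
      have h2 := (hB q hq).1 hTq i (y i) ((hmem y).1 hy i).1 ((hmem y).1 hy i).2
      have h3 := hClow i (q i) (q i + (y - q) i)
      simp only [Pi.sub_apply] at h3 ⊢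
      linarith
    linarith
  have hpd : ∀ d : Fin n → ℝ, d ≠ 0 → 0 < d ⬝ᵥ X.mulVec d := by
    intro d hd
    simpa using hXpd.dotProduct_mulVec_pos hd
  have hMin : ∀ qs ∈ Ω, (T qs = qs ↔ IsMinOn F Ω qs) := by
    intro q hq
    constructor
    · intro h y hy
      have h1 := hlow q hq h y hy
      have h2 : 0 ≤ (y - q) ⬝ᵥ X.mulVec (y - q) := by
        by_cases h3 : y - q = 0
        · simp [h3]
        · exact (hpd _ h3).le
      simp only [Set.mem_ofPred_eq]
      linarith
    · intro h
      rw [hB q hq]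
      intro i y hy1 hy2
      set d : Fin n → ℝ := Pi.single i (y - q i) with hd
      have hin : ∀ t : ℝ, 0 < t → t < 1 → q + t • d ∈ Ω := by
        intro t ht0 ht1
        rw [hmem]
        intro j
        have hj := (hmem q).1 hq j
        by_cases hji : j = i
        · subst hji
          simp only [hd, Pi.add_apply, Pi.smul_apply, Pi.single_eq_same, smul_eq_mul]
          constructor <;> nlinarith
        · simpa [hd, Pi.single_eq_of_ne hji] using hj
      have key : ∀ t : ℝ, 0 < t → t < 1 →
          0 ≤ (∑ j, d j * ((X.mulVec q + vtil) j - ginv j (q j + t * d j)))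
            + t * ((1/2) * (d ⬝ᵥ X.mulVec d)) := by
        intro t ht0 ht1
        have h1 : F q ≤ F (q + t • d) := h (hin t ht0 ht1)
        have h2 := hFd q (t • d)
        rw [← Finset.sum_add_distrib, Matrix.mulVec_smul, smul_dotProduct, dotProduct_smul] at h2
        have h3 : ∑ j, (C j (q j + (t • d) j) - C j (q j) + (t • d) j * (X.mulVec q + vtil) j)
            ≤ ∑ j, t * (d j * ((X.mulVec q + vtil) j - ginv j (q j + t * d j))) := by
          refine Finset.sum_le_sum fun j _ => ?_
          have h4 := hClow j (q j + t * d j) (q j)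
          simp only [Pi.smul_apply, smul_eq_mul]
          linarith
        rw [← Finset.mul_sum] at h3
        simp only [smul_eq_mul] at h2
        refine nonneg_of_mul_nonneg_right ?_ ht0
        linarith
      have hc : Continuous fun t : ℝ =>
          (∑ j, d j * ((X.mulVec q + vtil) j - ginv j (q j + t * d j)))
            + t * ((1/2) * (d ⬝ᵥ X.mulVec d)) := by
        refine Continuous.add (continuous_finsetSum _ fun j _ => ?_) (by fun_prop)
        exact continuous_const.mul (continuous_const.sub ((hGc j).comp (by fun_prop)))
      have hlim := (hc.tendsto 0).mono_left (nhdsWithin_le_nhds (s := Set.Ioi 0))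
      have h0 := ge_of_tendsto hlim (by
        filter_upwards [Ioo_mem_nhdsGT (show (0:ℝ) < 1 by norm_num)] with t ht
        exact key t ht.1 ht.2)
      simp only [zero_mul, add_zero] at h0
      rw [Finset.sum_eq_single i] at h0
      · simpa [hd] using h0
      · intro j _ hj
        simp [hd, Pi.single_eq_of_ne hj]
      · simp
  refine ⟨?_, hMin, hA⟩
  have hcomp : IsCompact Ω := by
    rw [hΩ]; exact isCompact_univ_pi fun i => isCompact_Icc
  have hne : Ω.Nonempty := ⟨0, (hmem 0).2 fun i => ⟨hmin i, hmax i⟩⟩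
  obtain ⟨q, hq, hqm⟩ := hcomp.exists_isMinOn hne hFc.continuousOn
  have hTq := (hMin q hq).2 hqm
  refine ⟨q, ⟨hq, hTq⟩, ?_⟩
  rintro y ⟨hy, hTy⟩
  by_contra hne
  have h1 := hlow q hq hTq y hy
  have h2 : F y ≤ F q := (hMin y hy).1 hTy hq
  have h3 := hpd (y - q) (sub_ne_zero.2 hne)
  linarith
end

section
/- Let M be an n×n real symmetric matrix with λ_max(M) > 0, let α_1, …, α_n > 0, and let A⁻¹ = diag(1/α_1, …, 1/α_n). If 0 < γ < 2 / (max_i α_i · λ_max(M)), then the matrix γ²M − 2γA⁻¹ is negative definite, i.e., xᵀ(γ²M − 2γA⁻¹)x < 0 for all nonzero x ∈ ℝⁿ. -/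
open Matrix

theorem quad_le_aux {n : ℕ} (M : Matrix (Fin n) (Fin n) ℝ) (hM : M.IsHermitian) (L : ℝ)
    (hL : ∀ i, hM.eigenvalues i ≤ L) (x : Fin n → ℝ) : x ⬝ᵥ (M *ᵥ x) ≤ L * (x ⬝ᵥ x) := by
  obtain ⟨U, hU⟩ : ∃ U : Matrix (Fin n) (Fin n) ℝ, U = hM.eigenvectorUnitary := ⟨_, rfl⟩
  have h1 : M = U * diagonal hM.eigenvalues * Uᵀ := by
    have h := hM.spectral_theorem
    rw [Unitary.conjStarAlgAut_apply] at h
    rw [hU]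
    exact h
  have h2 : U * Uᵀ = 1 := by
    rw [hU]
    exact Unitary.coe_mul_star_self hM.eigenvectorUnitary
  have h3 : x ⬝ᵥ x = (Uᵀ *ᵥ x) ⬝ᵥ (Uᵀ *ᵥ x) := by
    conv_rhs => rw [Matrix.dotProduct_mulVec, Matrix.vecMul_transpose, Matrix.mulVec_mulVec, h2,
      Matrix.one_mulVec]
  have h4 : x ⬝ᵥ (M *ᵥ x) = (Uᵀ *ᵥ x) ⬝ᵥ (diagonal hM.eigenvalues *ᵥ (Uᵀ *ᵥ x)) := by
    conv_lhs => rw [h1]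
    rw [← Matrix.mulVec_mulVec, ← Matrix.mulVec_mulVec, Matrix.dotProduct_mulVec x U,
      Matrix.mulVec_transpose]
  rw [h3, h4]
  simp only [dotProduct, Matrix.mulVec_diagonal, Finset.mul_sum]
  refine Finset.sum_le_sum fun i _ => ?_
  nlinarith [mul_le_mul_of_nonneg_right (hL i) (mul_self_nonneg ((Uᵀ *ᵥ x) i))]

/-- If `M` is real symmetric with `λ_max(M) > 0`, `α_i > 0`, and
`0 < γ < 2 / (max_i α_i · λ_max(M))`, then `γ²M − 2γA⁻¹` is negative
definite, where `A⁻¹ = diag(1/α_i)`. -/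
theorem stmt_5 (n : ℕ) (hn : 0 < n)
    (M : Matrix (Fin n) (Fin n) ℝ) (hM : M.IsHermitian)
    (α : Fin n → ℝ) (hα : ∀ i, 0 < α i)
    (hlam_pos : 0 < Finset.univ.sup' ⟨⟨0, hn⟩, Finset.mem_univ _⟩ hM.eigenvalues)
    (γ : ℝ) (hγ0 : 0 < γ)
    (hγ : γ < 2 / ((Finset.univ.sup' ⟨⟨0, hn⟩, Finset.mem_univ _⟩ α)
      * (Finset.univ.sup' ⟨⟨0, hn⟩, Finset.mem_univ _⟩ hM.eigenvalues))) :
    ∀ x : Fin n → ℝ, x ≠ 0 →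
      x ⬝ᵥ ((γ^2 • M - (2*γ) • Matrix.diagonal fun i => 1 / α i).mulVec x) < 0 := by
  intro x hx
  have hL : ∀ i, hM.eigenvalues i ≤ Finset.univ.sup' ⟨⟨0, hn⟩, Finset.mem_univ _⟩ hM.eigenvalues := fun i =>
    Finset.le_sup' (s := Finset.univ) hM.eigenvalues (Finset.mem_univ i)
  have hK : ∀ i, α i ≤ Finset.univ.sup' ⟨⟨0, hn⟩, Finset.mem_univ _⟩ α := fun i =>
    Finset.le_sup' (s := Finset.univ) α (Finset.mem_univ i)
  have hq := quad_le_aux M hM _ hL x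
  set L := Finset.univ.sup' ⟨⟨0, hn⟩, Finset.mem_univ _⟩ hM.eigenvalues
  set K := Finset.univ.sup' ⟨⟨0, hn⟩, Finset.mem_univ _⟩ α
  have hKpos : 0 < K := lt_of_lt_of_le (hα ⟨0, hn⟩) (hK _)
  have hxx : 0 < x ⬝ᵥ x := by
    refine lt_of_le_of_ne (Finset.sum_nonneg fun i _ => mul_self_nonneg _) fun h => hx ?_
    exact dotProduct_self_eq_zero.mp h.symm
  have hd : (1 / K) * (x ⬝ᵥ x) ≤ x ⬝ᵥ ((diagonal fun i => 1 / α i) *ᵥ x) := by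
    simp only [dotProduct, Matrix.mulVec_diagonal, Finset.mul_sum]
    refine Finset.sum_le_sum fun i _ => ?_
    have := one_div_le_one_div_of_le (hα i) (hK i)
    nlinarith [mul_le_mul_of_nonneg_right this (mul_self_nonneg (x i))]
  rw [Matrix.sub_mulVec, Matrix.smul_mulVec, Matrix.smul_mulVec, dotProduct_sub, dotProduct_smul,
    dotProduct_smul, smul_eq_mul, smul_eq_mul]
  have hg : γ * L < 2 * (1 / K) := by
    rw [lt_div_iff₀ (mul_pos hKpos hlam_pos)] at hγ
    rw [mul_one_div, lt_div_iff₀ hKpos]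
    linarith
  have e1 := mul_le_mul_of_nonneg_left hq (sq_nonneg γ)
  have e2 := mul_le_mul_of_nonneg_left hd (by positivity : 0 ≤ 2 * γ)
  have e3 := mul_lt_mul_of_pos_left (mul_lt_mul_of_pos_right hg hxx) hγ0
  linarith
end

section
/- Let X be a symmetric positive definite n×n real matrix, ṽ ∈ ℝⁿ. For each i let g_i : ℝ → ℝ be a continuously differentiable strictly decreasing bijection with −α_i ≤ g_i′(v) < 0 for all v, let f_i(v) = min(q_i^max, max(q_i^min, g_i(v))), C_i(q) = −∫₀^q g_i⁻¹(s) ds, C(q) = Σ_i C_i(q_i), F(q) = C(q) + ½ qᵀXq + qᵀṽ, and let ∇²C(q) = diag(−(g_i⁻¹)′(q_i)). Suppose the stepsize γ_p > 0 satisfies γ_p · (max_i α_i) · sup_{q ∈ Ω} λ_max(∇²C(q) + X) < 2. Then for any q ∈ Ω, the one-step pseudo-gradient update q⁺ = clamp_Ω(q − γ_p (q − f(Xq + ṽ))) satisfies F(q⁺) ≤ F(q), with equality if and only if q⁺ = q. -/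
open Matrix

theorem aux_taylor (φ φ1 φ2 : ℝ → ℝ) (K : ℝ) (h1 : ∀ t, HasDerivAt φ (φ1 t) t)
    (h2 : ∀ t, HasDerivAt φ1 (φ2 t) t) (h : ∀ t ∈ Set.Icc (0:ℝ) 1, φ2 t ≤ K) :
    φ 1 ≤ φ 0 + φ1 0 + K / 2 := by
  have d1 : ∀ t, HasDerivAt (fun t => φ1 t - K * t) (φ2 t - K) t := fun t => by
    exact ((h2 t).sub ((hasDerivAt_id t).const_mul K)).congr_deriv (by simp)
  have a1 : AntitoneOn (fun t => φ1 t - K * t) (Set.Icc 0 1) := by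
    apply antitoneOn_of_deriv_nonpos (convex_Icc 0 1)
    · exact fun t _ => (d1 t).continuousAt.continuousWithinAt
    · exact fun t _ => (d1 t).differentiableAt.differentiableWithinAt
    · intro t ht
      rw [(d1 t).deriv]
      linarith [h t (interior_subset ht)]
  have d2 : ∀ t, HasDerivAt (fun t => φ t - (φ1 0 * t + K / 2 * t ^ 2))
      (φ1 t - (φ1 0 + K * t)) t := fun t => by
    have := (h1 t).sub (((hasDerivAt_id t).const_mul (φ1 0)).add
      (((hasDerivAt_id t).pow 2).const_mul (K / 2)))
    refine this.congr_deriv ?_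
    simp
    ring
  have a2 : AntitoneOn (fun t => φ t - (φ1 0 * t + K / 2 * t ^ 2)) (Set.Icc 0 1) := by
    apply antitoneOn_of_deriv_nonpos (convex_Icc 0 1)
    · exact fun t _ => (d2 t).continuousAt.continuousWithinAt
    · exact fun t _ => (d2 t).differentiableAt.differentiableWithinAt
    · intro t ht
      rw [(d2 t).deriv]
      have ht' := interior_subset ht
      have := a1 (Set.left_mem_Icc.2 zero_le_one) ht' ht'.1
      simp only [mul_zero, sub_zero] at this
      linarith
  have := a2 (Set.left_mem_Icc.2 zero_le_one) (Set.right_mem_Icc.2 zero_le_one) zero_le_one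
  norm_num at this
  linarith

theorem aux_lip (g g' : ℝ → ℝ) (α : ℝ) (hd : ∀ v, HasDerivAt g (g' v) v)
    (hb : ∀ v, -α ≤ g' v) {u v : ℝ} (huv : u ≤ v) : g u - g v ≤ α * (v - u) := by
  have d1 : ∀ t, HasDerivAt (fun t => g t + α * t) (g' t + α) t := fun t => by
    exact ((hd t).add ((hasDerivAt_id t).const_mul α)).congr_deriv (by simp)
  have a : Monotone (fun t => g t + α * t) := by
    apply monotone_of_deriv_nonneg
    · exact fun t => (d1 t).differentiableAt
    · intro t
      rw [(d1 t).deriv]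
      linarith [hb t]
  have := a huv
  simp only at this
  linarith

theorem aux_clamp (a b q y γ α w : ℝ) (hq1 : a ≤ q) (hq2 : q ≤ b) (hγ : 0 < γ) (hα : 0 < α)
    (hw : 0 ≤ w ∧ y ≤ q ∧ q - y ≤ α * w ∨ w ≤ 0 ∧ q ≤ y ∧ y - q ≤ α * (-w)) (d : ℝ)
    (hd : d = max a (min b (q - γ * (q - min b (max a y)))) - q) :
    d ^ 2 ≤ γ * α * (-(d * w)) := by
  rcases hw with ⟨h1, h2, h3⟩ | ⟨h1, h2, h3⟩
  · have e1 : min b (max a y) ≤ q := (min_le_right _ _).trans (max_le hq1 h2)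
    have e2 : y ≤ min b (max a y) := le_min (h2.trans hq2) (le_max_right _ _)
    have e3 : 0 ≤ γ * (q - min b (max a y)) := mul_nonneg hγ.le (by linarith)
    have e4 : γ * (q - min b (max a y)) ≤ γ * (α * w) :=
      mul_le_mul_of_nonneg_left (by linarith) hγ.le
    have e5 : d ≤ 0 := by
      rw [hd]
      have := max_le hq1 ((min_le_right b (q - γ * (q - min b (max a y)))).trans (by linarith))
      linarith
    have e6 : -(γ * (α * w)) ≤ d := by
      rw [hd]
      have : q - γ * (q - min b (max a y)) ≤ max a (min b (q - γ * (q - min b (max a y)))) :=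
        (le_min (by linarith) le_rfl).trans (le_max_right _ _)
      linarith
    nlinarith
  · have e1 : q ≤ min b (max a y) := le_min hq2 (h2.trans (le_max_right _ _))
    have e2 : min b (max a y) ≤ y := (min_le_right _ _).trans (max_le (hq1.trans h2) le_rfl)
    have e3 : 0 ≤ γ * (min b (max a y) - q) := mul_nonneg hγ.le (by linarith)
    have e4 : γ * (min b (max a y) - q) ≤ γ * (α * (-w)) :=
      mul_le_mul_of_nonneg_left (by linarith) hγ.le
    have e5 : 0 ≤ d := by
      rw [hd]
      have : q ≤ max a (min b (q - γ * (q - min b (max a y)))) :=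
        (le_min hq2 (by linarith)).trans (le_max_right _ _)
      linarith
    have e6 : d ≤ γ * (α * (-w)) := by
      rw [hd]
      have : max a (min b (q - γ * (q - min b (max a y)))) ≤ q + γ * (min b (max a y) - q) :=
        max_le (by linarith) ((min_le_right _ _).trans (by linarith))
      linarith
    nlinarith

/-- One-step descent of the pseudo-gradient update under condition C3:
if `γ_p · max_i α_i · sup_{q∈Ω} λ_max(∇²C(q) + X) < 2`, then
`F(q⁺) ≤ F(q)` with equality iff `q⁺ = q`, where
`q⁺ = clamp_Ω(q − γ_p(q − f(Xq + ṽ)))`. -/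
theorem stmt_6 (n : ℕ) (hn : 0 < n)
    (X : Matrix (Fin n) (Fin n) ℝ) (hXsym : X.IsSymm) (hXpd : X.PosDef)
    (vtil : Fin n → ℝ)
    (qmin qmax : Fin n → ℝ) (hmin : ∀ i, qmin i ≤ 0) (hmax : ∀ i, 0 ≤ qmax i)
    (α : Fin n → ℝ) (hα : ∀ i, 0 < α i)
    (g g' ginv ginv' : Fin n → ℝ → ℝ)
    (hg_deriv : ∀ i v, HasDerivAt (g i) (g' i v) v)
    (hg'_cont : ∀ i, Continuous (g' i))
    (hg'_bound : ∀ i v, -α i ≤ g' i v ∧ g' i v < 0)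
    (hg_anti : ∀ i, StrictAnti (g i))
    (hg_bij : ∀ i, Function.Bijective (g i))
    (hginv : ∀ i, Function.LeftInverse (ginv i) (g i) ∧ Function.RightInverse (ginv i) (g i))
    (hginv_deriv : ∀ i s, HasDerivAt (ginv i) (ginv' i s) s)
    (f : Fin n → ℝ → ℝ)
    (hf : ∀ i v, f i v = min (qmax i) (max (qmin i) (g i v)))
    (C : Fin n → ℝ → ℝ)
    (hC : ∀ i q, C i q = -∫ s in (0:ℝ)..q, ginv i s)
    (F : (Fin n → ℝ) → ℝ)
    (hF : ∀ q, F q = (∑ i, C i (q i)) + (1/2) * (q ⬝ᵥ X.mulVec q) + q ⬝ᵥ vtil)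
    (Ω : Set (Fin n → ℝ))
    (hΩ : Ω = Set.univ.pi fun i => Set.Icc (qmin i) (qmax i))
    (γp : ℝ) (hγp : 0 < γp)
    (Λ : ℝ)
    (hΛ : ∀ q ∈ Ω, ∀ x : Fin n → ℝ,
      x ⬝ᵥ ((Matrix.diagonal (fun i => -(ginv' i (q i))) + X).mulVec x) ≤ Λ * (x ⬝ᵥ x))
    (hC3 : γp * (Finset.univ.sup' ⟨⟨0, hn⟩, Finset.mem_univ _⟩ α) * Λ < 2)
    (T : (Fin n → ℝ) → (Fin n → ℝ))
    (hT : ∀ q i, T q i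
      = max (qmin i) (min (qmax i) (q i - γp * (q i - f i ((X.mulVec q + vtil) i))))) :
    ∀ q ∈ Ω, F (T q) ≤ F q ∧ (F (T q) = F q ↔ T q = q) := by
  intro q hq
  have hqi : ∀ i, qmin i ≤ q i ∧ q i ≤ qmax i := by
    rw [hΩ] at hq
    exact fun i => hq i (Set.mem_univ i)
  obtain ⟨d, hd⟩ : ∃ d : Fin n → ℝ, d = T q - q := ⟨_, rfl⟩
  have hTq : T q = q + d := by rw [hd]; abel
  have hTi : ∀ i, qmin i ≤ q i + d i ∧ q i + d i ≤ qmax i := by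
    intro i
    have : q i + d i = T q i := by rw [hTq]; rfl
    rw [this, hT]
    exact ⟨le_max_left _ _, max_le ((hmin i).trans (hmax i)) (min_le_left _ _)⟩
  have hgc : ∀ i, Continuous (ginv i) := fun i =>
    continuous_iff_continuousAt.2 fun s => (hginv_deriv i s).continuousAt
  have hCd : ∀ i s, HasDerivAt (C i) (-ginv i s) s := by
    intro i s
    have : C i = fun q => -∫ s in (0:ℝ)..q, ginv i s := funext (hC i)
    rw [this]
    exact (intervalIntegral.integral_hasDerivAt_right ((hgc i).intervalIntegrable _ _)
      ((hgc i).stronglyMeasurableAtFilter _ _) (hgc i).continuousAt).neg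
  obtain ⟨A, hA⟩ : ∃ A, A = Finset.univ.sup' ⟨⟨0, hn⟩, Finset.mem_univ _⟩ α := ⟨_, rfl⟩
  have hAle : ∀ i, α i ≤ A := fun i => by
    rw [hA]; exact Finset.le_sup' α (Finset.mem_univ i)
  have hA0 : 0 < A := (hα ⟨0, hn⟩).trans_le (hAle _)
  rw [← hA] at hC3
  -- componentwise descent
  have hcomp : ∀ i, d i ^ 2 ≤ γp * A * (-(d i * ((X.mulVec q + vtil) i - ginv i (q i)))) := by
    intro i
    have hgi : g i (ginv i (q i)) = q i := (hginv i).2 (q i)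
    have key := aux_clamp (qmin i) (qmax i) (q i) (g i ((X.mulVec q + vtil) i)) γp A
      ((X.mulVec q + vtil) i - ginv i (q i)) (hqi i).1 (hqi i).2 hγp hA0 ?_ (d i) ?_
    · exact key
    · rcases le_total (ginv i (q i)) ((X.mulVec q + vtil) i) with h | h
      · left
        have := aux_lip (g i) (g' i) (α i) (hg_deriv i) (fun v => (hg'_bound i v).1) h
        have h2 := (hg_anti i).antitone h
        rw [hgi] at this h2
        refine ⟨by linarith, h2, this.trans ?_⟩
        exact mul_le_mul_of_nonneg_right (hAle i) (by linarith)
      · right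
        have := aux_lip (g i) (g' i) (α i) (hg_deriv i) (fun v => (hg'_bound i v).1) h
        have h2 := (hg_anti i).antitone h
        rw [hgi] at this h2
        refine ⟨by linarith, h2, this.trans ?_⟩
        rw [neg_sub]
        exact mul_le_mul_of_nonneg_right (hAle i) (by linarith)
    · rw [hd, Pi.sub_apply, hT, hf]
  -- Taylor
  have hsymm : q ⬝ᵥ X.mulVec d = d ⬝ᵥ X.mulVec q := by
    rw [Matrix.dotProduct_mulVec, ← Matrix.mulVec_transpose, hXsym.eq, dotProduct_comm]
  have hlin : ∀ i t, HasDerivAt (fun t : ℝ => q i + t * d i) (d i) t := fun i t => by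
    simpa using ((hasDerivAt_id t).mul_const (d i)).const_add (q i)
  have htay := aux_taylor
    (fun t => (∑ i, C i (q i + t * d i)) + ((1/2) * (q ⬝ᵥ X.mulVec q) + q ⬝ᵥ vtil
      + (t * (d ⬝ᵥ X.mulVec q + d ⬝ᵥ vtil) + t ^ 2 * ((1/2) * (d ⬝ᵥ X.mulVec d)))))
    (fun t => (∑ i, -ginv i (q i + t * d i) * d i) + (d ⬝ᵥ X.mulVec q + d ⬝ᵥ vtil
      + t * (d ⬝ᵥ X.mulVec d)))
    (fun t => (∑ i, -(ginv' i (q i + t * d i) * d i) * d i) + d ⬝ᵥ X.mulVec d)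
    (Λ * (d ⬝ᵥ d)) ?_ ?_ ?_
  rotate_left
  · intro t
    have s1 : HasDerivAt (fun t => ∑ i, C i (q i + t * d i))
        (∑ i, -ginv i (q i + t * d i) * d i) t :=
      HasDerivAt.fun_sum fun i _ => (hCd i (q i + t * d i)).comp t (hlin i t)
    refine s1.add ?_
    have := ((((hasDerivAt_id t).mul_const (d ⬝ᵥ X.mulVec q + d ⬝ᵥ vtil)).add
      (((hasDerivAt_id t).pow 2).mul_const ((1/2) * (d ⬝ᵥ X.mulVec d)))).const_add
      ((1/2) * (q ⬝ᵥ X.mulVec q) + q ⬝ᵥ vtil))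
    refine this.congr_deriv ?_
    simp
    ring
  · intro t
    have s1 : HasDerivAt (fun t => ∑ i, -ginv i (q i + t * d i) * d i)
        (∑ i, -(ginv' i (q i + t * d i) * d i) * d i) t :=
      HasDerivAt.fun_sum fun i _ =>
        (((hginv_deriv i (q i + t * d i)).comp t (hlin i t)).neg).mul_const (d i)
    refine s1.add ?_
    have := (((hasDerivAt_id t).mul_const (d ⬝ᵥ X.mulVec d))).const_add
      (d ⬝ᵥ X.mulVec q + d ⬝ᵥ vtil)
    refine this.congr_deriv ?_
    simp
  · intro t ht
    have hmem : (fun i => q i + t * d i) ∈ Ω := by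
      rw [hΩ]
      intro i _
      have h1 := hqi i
      have h2 := hTi i
      constructor <;> simp only <;> nlinarith [ht.1, ht.2]
    have := hΛ _ hmem d
    refine le_trans (le_of_eq ?_) this
    rw [Matrix.add_mulVec, dotProduct_add]
    congr 1
    simp only [dotProduct, Matrix.mulVec_diagonal]
    exact Finset.sum_congr rfl fun i _ => by ring
  have hF1 : F (T q) = (∑ i, C i (q i + 1 * d i)) + ((1/2) * (q ⬝ᵥ X.mulVec q) + q ⬝ᵥ vtil
      + (1 * (d ⬝ᵥ X.mulVec q + d ⬝ᵥ vtil) + 1 ^ 2 * ((1/2) * (d ⬝ᵥ X.mulVec d)))) := by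
    rw [hTq, hF]
    simp only [Matrix.mulVec_add, add_dotProduct, dotProduct_add, hsymm, Pi.add_apply, one_mul]
    ring
  have hF0 : F q = ∑ i, C i (q i) + ((1/2) * (q ⬝ᵥ X.mulVec q) + q ⬝ᵥ vtil) := by
    rw [hF]; ring
  have hsum : d ⬝ᵥ d ≤ γp * A * (-(∑ i, -ginv i (q i) * d i
      + (d ⬝ᵥ X.mulVec q + d ⬝ᵥ vtil))) := by
    have h1 : d ⬝ᵥ d = ∑ i, d i ^ 2 := by
      simp only [dotProduct]; exact Finset.sum_congr rfl fun i _ => by ring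
    have h2 : ∑ i, -ginv i (q i) * d i + (d ⬝ᵥ X.mulVec q + d ⬝ᵥ vtil)
        = ∑ i, d i * ((X.mulVec q + vtil) i - ginv i (q i)) := by
      simp only [dotProduct, ← Finset.sum_add_distrib, Pi.add_apply]
      exact Finset.sum_congr rfl fun i _ => by ring
    rw [h1, h2, ← Finset.sum_neg_distrib, Finset.mul_sum]
    exact Finset.sum_le_sum fun i _ => hcomp i
  rw [← hF1] at htay
  simp only [zero_mul, add_zero, ne_eq, OfNat.ofNat_ne_zero, not_false_eq_true, zero_pow] at htay
  rw [← hF0] at htay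
  have hP : 0 < γp * A := mul_pos hγp hA0
  have hstrict : T q ≠ q → F (T q) < F q := by
    intro hne
    have hd0 : d ≠ 0 := fun h => hne (by rw [hTq, h, add_zero])
    have hdd : 0 < d ⬝ᵥ d := by
      have h0 : 0 ≤ d ⬝ᵥ d := Finset.sum_nonneg fun i _ => mul_self_nonneg (d i)
      exact lt_of_le_of_ne h0 fun h => hd0 (dotProduct_self_eq_zero.1 h.symm)
    have h3 : γp * A * Λ * (d ⬝ᵥ d) < 2 * (d ⬝ᵥ d) := mul_lt_mul_of_pos_right hC3 hdd
    have h4 : γp * A * (F (T q) - F q) < 0 := by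
      have := mul_le_mul_of_nonneg_left htay hP.le
      nlinarith
    by_contra hcon
    have := mul_nonneg hP.le (sub_nonneg.2 (not_lt.1 hcon))
    linarith
  by_cases h : T q = q
  · simp [h]
  · have := hstrict h
    exact ⟨this.le, fun e => absurd e this.ne, fun e => absurd e h⟩
end

section
/- (Theorem 2, convergence under condition C3) Let X be a symmetric positive definite n×n real matrix, ṽ ∈ ℝⁿ. For each i let g_i : ℝ → ℝ be a continuously differentiable strictly decreasing bijection with −α_i ≤ g_i′(v) < 0 for all v, let f_i(v) = min(q_i^max, max(q_i^min, g_i(v))), C_i(q) = −∫₀^q g_i⁻¹(s) ds, F(q) = Σ_i C_i(q_i) + ½ qᵀXq + qᵀṽ, and ∇²C(q) = diag(−(g_i⁻¹)′(q_i)). Suppose the stepsize γ_p > 0 satisfies condition C3: γ_p · (max_i α_i) · sup_{q ∈ Ω} λ_max(∇²C(q) + X) < 2. Then for any initial point q(0) ∈ Ω, the sequence defined by q(t+1) = clamp_Ω(q(t) − γ_p (q(t) − f(Xq(t) + ṽ))) converges to the unique minimizer q* of F over Ω, and the voltages v(t) = Xq(t) + ṽ converge to v* = Xq* + ṽ. 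-/
open Matrix


lemma aux_clamp_s7 (lo hi q gv u v γ A d' q' : ℝ) (hlo : lo ≤ q) (hhi : q ≤ hi) (hγ : 0 < γ)
    (h1 : u ≤ v → gv ≤ q ∧ q - gv ≤ A * (v - u))
    (h2 : v ≤ u → q ≤ gv ∧ gv - q ≤ A * (u - v))
    (hd : d' = min hi (max lo gv))
    (hq' : q' = max lo (min hi (q - γ * (q - d')))) :
    (v - u) * (q' - q) * (γ * A) ≤ -(q' - q)^2 := by
  rcases le_total u v with h | h
  · obtain ⟨ha, hb⟩ := h1 h
    have hd1 : d' = max lo gv := by rw [hd]; exact min_eq_right (max_le (hlo.trans hhi) (ha.trans hhi))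
    have hd2 : d' ≤ q := by rw [hd1]; exact max_le hlo ha
    have hd3 : gv ≤ d' := by rw [hd1]; exact le_max_right _ _
    have h5 : 0 ≤ γ * (q - d') := mul_nonneg hγ.le (by linarith)
    have hq1 : q' = max lo (q - γ * (q - d')) := by rw [hq', min_eq_right (by linarith)]
    have hq2 : q' ≤ q := by rw [hq1]; exact max_le hlo (by linarith)
    have hq3 : q - γ * (q - d') ≤ q' := by rw [hq1]; exact le_max_right _ _
    have h6 : γ * (q - d') ≤ γ * (A * (v - u)) := mul_le_mul_of_nonneg_left (by linarith) hγ.le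
    have h7 : (q - q') * (q - q') ≤ (q - q') * (γ * (A * (v - u))) :=
      mul_le_mul_of_nonneg_left (by linarith) (by linarith)
    nlinarith
  · obtain ⟨ha, hb⟩ := h2 h
    have hd1 : d' = min hi gv := by rw [hd, max_eq_right (hlo.trans ha)]
    have hd2 : q ≤ d' := by rw [hd1]; exact le_min hhi ha
    have hd3 : d' ≤ gv := by rw [hd1]; exact min_le_right _ _
    have h5 : 0 ≤ γ * (d' - q) := mul_nonneg hγ.le (by linarith)
    have h50 : lo ≤ min hi (q - γ * (q - d')) := le_min (hlo.trans hhi) (by nlinarith)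
    have hq1 : q' = min hi (q - γ * (q - d')) := by rw [hq', max_eq_right h50]
    have hq2 : q ≤ q' := by rw [hq1]; exact le_min hhi (by nlinarith)
    have hq3 : q' ≤ q - γ * (q - d') := by rw [hq1]; exact min_le_right _ _
    have h6 : γ * (d' - q) ≤ γ * (A * (u - v)) := mul_le_mul_of_nonneg_left (by linarith) hγ.le
    have h7 : (q' - q) * (q' - q) ≤ (q' - q) * (γ * (A * (u - v))) :=
      mul_le_mul_of_nonneg_left (by linarith) (by linarith)
    nlinarith

lemma aux_fixed (lo hi q γ d : ℝ) (hlo : lo ≤ d) (hhi : d ≤ hi) (hγ : 0 < γ)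
    (h : q = max lo (min hi (q - γ * (q - d)))) : q = d := by
  rcases lt_trichotomy q d with hd | hd | hd
  · have : 0 < γ * (d - q) := mul_pos hγ (by linarith)
    have h2 : q < min hi (q - γ * (q - d)) := lt_min (by linarith) (by nlinarith)
    have h3 := le_max_right lo (min hi (q - γ * (q - d)))
    linarith
  · exact hd
  · have : 0 < γ * (q - d) := mul_pos hγ (by linarith)
    have h3 : max lo (min hi (q - γ * (q - d))) < q :=
      max_lt (by linarith) ((min_le_right _ _).trans_lt (by linarith))
    linarith

lemma aux_taylor_s7 (φ φ' φ'' : ℝ → ℝ) (M : ℝ) (h1 : ∀ s, HasDerivAt φ (φ' s) s)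
    (h2 : ∀ s, HasDerivAt φ' (φ'' s) s) (hM : ∀ s ∈ Set.Icc (0:ℝ) 1, φ'' s ≤ M) :
    φ 1 ≤ φ 0 + φ' 0 + M / 2 := by
  have ha : AntitoneOn (fun s => φ' s - M * s) (Set.Icc 0 1) := by
    have hd : ∀ s, HasDerivAt (fun s => φ' s - M * s) (φ'' s - M * 1) s := fun s =>
      (h2 s).sub ((hasDerivAt_id s).const_mul M)
    refine antitoneOn_of_deriv_nonpos (convex_Icc _ _)
      (fun s _ => (hd s).continuousAt.continuousWithinAt)
      (fun s _ => (hd s).differentiableAt.differentiableWithinAt) ?_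
    intro s hs
    rw [(hd s).deriv]
    have := hM s (interior_subset hs)
    linarith
  have hb : AntitoneOn (fun s => φ s - φ' 0 * s - M / 2 * s ^ 2) (Set.Icc 0 1) := by
    have hd : ∀ s, HasDerivAt (fun s => φ s - φ' 0 * s - M / 2 * s ^ 2)
        (φ' s - φ' 0 * 1 - M / 2 * (2 * s)) s := fun s => by
      have h3 : HasDerivAt (fun s : ℝ => s ^ 2) (2 * s) s := by simpa using hasDerivAt_pow 2 s
      exact ((h1 s).sub ((hasDerivAt_id s).const_mul (φ' 0))).sub (h3.const_mul (M / 2))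
    refine antitoneOn_of_deriv_nonpos (convex_Icc _ _)
      (fun s _ => (hd s).continuousAt.continuousWithinAt)
      (fun s _ => (hd s).differentiableAt.differentiableWithinAt) ?_
    intro s hs
    rw [(hd s).deriv]
    have hs' : s ∈ Set.Icc (0:ℝ) 1 := interior_subset hs
    have := ha (Set.left_mem_Icc.2 zero_le_one) hs' hs'.1
    simp only at this
    linarith
  have := hb (Set.left_mem_Icc.2 zero_le_one) (Set.right_mem_Icc.2 zero_le_one) zero_le_one
  simp only at this
  linarith

lemma aux_convex (c c' : ℝ → ℝ) (h : ∀ s, HasDerivAt c (c' s) s) (hm : Monotone c') (p q : ℝ) :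
    c q + c' q * (p - q) ≤ c p := by
  rcases lt_trichotomy q p with hl | hl | hl
  · obtain ⟨z, hz, hz'⟩ := exists_hasDerivAt_eq_slope c c' hl
      (fun s _ => (h s).continuousAt.continuousWithinAt) (fun s _ => h s)
    rw [eq_div_iff (by linarith)] at hz'
    have := mul_le_mul_of_nonneg_right (hm hz.1.le) (sub_nonneg.2 hl.le)
    linarith
  · subst hl; simp
  · obtain ⟨z, hz, hz'⟩ := exists_hasDerivAt_eq_slope c c' hl
      (fun s _ => (h s).continuousAt.continuousWithinAt) (fun s _ => h s)
    rw [eq_div_iff (by linarith)] at hz'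
    have := mul_le_mul_of_nonneg_right (hm hz.2.le) (sub_nonneg.2 hl.le)
    linarith

/-- Theorem 2 (convergence under condition C3): under condition C3 on the
stepsize, the pseudo-gradient dynamics `D3` converges from any initial point
in `Ω` to the unique minimizer `q*` of `F` over `Ω`, and the voltages
`v(t) = Xq(t) + ṽ` converge to `v* = Xq* + ṽ`. -/
theorem stmt_7 (n : ℕ) (hn : 0 < n)
    (X : Matrix (Fin n) (Fin n) ℝ) (hXsym : X.IsSymm) (hXpd : X.PosDef)
    (vtil : Fin n → ℝ)
    (qmin qmax : Fin n → ℝ) (hmin : ∀ i, qmin i ≤ 0) (hmax : ∀ i, 0 ≤ qmax i)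
    (α : Fin n → ℝ) (hα : ∀ i, 0 < α i)
    (g g' ginv ginv' : Fin n → ℝ → ℝ)
    (hg_deriv : ∀ i v, HasDerivAt (g i) (g' i v) v)
    (hg'_cont : ∀ i, Continuous (g' i))
    (hg'_bound : ∀ i v, -α i ≤ g' i v ∧ g' i v < 0)
    (hg_anti : ∀ i, StrictAnti (g i))
    (hg_bij : ∀ i, Function.Bijective (g i))
    (hginv : ∀ i, Function.LeftInverse (ginv i) (g i) ∧ Function.RightInverse (ginv i) (g i))
    (hginv_deriv : ∀ i s, HasDerivAt (ginv i) (ginv' i s) s)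
    (f : Fin n → ℝ → ℝ)
    (hf : ∀ i v, f i v = min (qmax i) (max (qmin i) (g i v)))
    (C : Fin n → ℝ → ℝ)
    (hC : ∀ i q, C i q = -∫ s in (0:ℝ)..q, ginv i s)
    (F : (Fin n → ℝ) → ℝ)
    (hF : ∀ q, F q = (∑ i, C i (q i)) + (1/2) * (q ⬝ᵥ X.mulVec q) + q ⬝ᵥ vtil)
    (Ω : Set (Fin n → ℝ))
    (hΩ : Ω = Set.univ.pi fun i => Set.Icc (qmin i) (qmax i))
    (γp : ℝ) (hγp : 0 < γp)
    (Λ : ℝ)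
    (hΛ : ∀ q ∈ Ω, ∀ x : Fin n → ℝ,
      x ⬝ᵥ ((Matrix.diagonal (fun i => -(ginv' i (q i))) + X).mulVec x) ≤ Λ * (x ⬝ᵥ x))
    (hC3 : γp * (Finset.univ.sup' ⟨⟨0, hn⟩, Finset.mem_univ _⟩ α) * Λ < 2)
    (q : ℕ → Fin n → ℝ) (hq0 : q 0 ∈ Ω)
    (hqrec : ∀ t, ∀ i, q (t+1) i
      = max (qmin i) (min (qmax i)
          (q t i - γp * (q t i - f i ((X.mulVec (q t) + vtil) i))))) :
    ∃ qstar, qstar ∈ Ω ∧ IsMinOn F Ω qstar ∧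
      (∀ p ∈ Ω, IsMinOn F Ω p → p = qstar) ∧
      Filter.Tendsto q Filter.atTop (nhds qstar) ∧
      Filter.Tendsto (fun t => X.mulVec (q t) + vtil) Filter.atTop
        (nhds (X.mulVec qstar + vtil)) := by
  classical
  obtain ⟨A, hA⟩ : ∃ A, A = Finset.univ.sup' ⟨⟨0, hn⟩, Finset.mem_univ _⟩ α := ⟨_, rfl⟩
  rw [← hA] at hC3
  have hαA : ∀ i, α i ≤ A := fun i => by rw [hA]; exact Finset.le_sup' α (Finset.mem_univ i)
  have hApos : 0 < A := (hα ⟨0, hn⟩).trans_le (hαA _)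
  have hγA : 0 < γp * A := mul_pos hγp hApos
  have hgg : ∀ i s, g i (ginv i s) = s := fun i => (hginv i).2
  have hgg' : ∀ i s, ginv i (g i s) = s := fun i => (hginv i).1
  have hginv_anti : ∀ i, Antitone (ginv i) := by
    intro i a b hab
    by_contra! hc
    have := hg_anti i hc
    rw [hgg, hgg] at this
    linarith
  have hginv_cont : ∀ i, Continuous (ginv i) := fun i =>
    continuous_iff_continuousAt.2 fun s => (hginv_deriv i s).continuousAt
  have hCd : ∀ i s, HasDerivAt (C i) (-ginv i s) s := by
    intro i s
    have h1 : C i = fun q => -∫ s in (0:ℝ)..q, ginv i s := funext (hC i)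
    rw [h1]
    exact (intervalIntegral.integral_hasDerivAt_right ((hginv_cont i).intervalIntegrable _ _)
      ((hginv_cont i).stronglyMeasurableAtFilter _ _) (hginv_cont i).continuousAt).neg
  have hCcont : ∀ i, Continuous (C i) := fun i =>
    continuous_iff_continuousAt.2 fun s => (hCd i s).continuousAt
  have hlip : ∀ i a b, a ≤ b → g i a - g i b ≤ A * (b - a) := by
    intro i a b hab
    have h1 := mul_sub_le_image_sub_of_le_deriv (f := g i) (C := -α i)
      (fun s => (hg_deriv i s).differentiableAt)
      (fun s => by rw [(hg_deriv i s).deriv]; exact (hg'_bound i s).1) hab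
    have h2 := mul_le_mul_of_nonneg_right (hαA i) (sub_nonneg.2 hab)
    linarith
  -- expansion of F
  have hexp : ∀ a b : Fin n → ℝ, F b = F a + (∑ i, (C i (b i) - C i (a i)))
      + (∑ i, (X.mulVec a + vtil) i * (b i - a i)) + (1/2) * ((b - a) ⬝ᵥ X.mulVec (b - a)) := by
    intro a b
    have hs : a ⬝ᵥ X.mulVec b = b ⬝ᵥ X.mulVec a := by
      rw [Matrix.dotProduct_mulVec, ← Matrix.mulVec_transpose, hXsym.eq, dotProduct_comm]
    have h3 : (∑ i, (X.mulVec a + vtil) i * (b i - a i)) = (b - a) ⬝ᵥ (X.mulVec a + vtil) := by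
      simp only [dotProduct, Pi.sub_apply]
      exact Finset.sum_congr rfl fun i _ => mul_comm _ _
    rw [hF, hF, h3, Finset.sum_sub_distrib]
    simp only [Matrix.mulVec_sub, dotProduct_sub, sub_dotProduct, dotProduct_add]
    rw [hs]
    ring
  have hmem : ∀ p, p ∈ Ω ↔ ∀ i, qmin i ≤ p i ∧ p i ≤ qmax i := by
    intro p; rw [hΩ]; simp only [Set.mem_pi, Set.mem_univ, true_imp_iff, Set.mem_Icc]
  have hconv : Convex ℝ Ω := by
    rw [hΩ]; exact convex_pi fun i _ => convex_Icc _ _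
  have hcpt : IsCompact Ω := by
    rw [hΩ]; exact isCompact_univ_pi fun i => isCompact_Icc
  have hFcont : Continuous F := by
    have : F = fun q => (∑ i, C i (q i)) + (1/2) * (q ⬝ᵥ X.mulVec q) + q ⬝ᵥ vtil := funext hF
    rw [this]
    have h1 : Continuous fun q : Fin n → ℝ => ∑ i, C i (q i) :=
      continuous_finsetSum _ fun i _ => (hCcont i).comp (continuous_apply i)
    have h2 : Continuous fun q : Fin n → ℝ => q ⬝ᵥ X.mulVec q :=
      Continuous.dotProduct continuous_id (Continuous.matrix_mulVec continuous_const continuous_id)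
    have h3 : Continuous fun q : Fin n → ℝ => q ⬝ᵥ vtil :=
      Continuous.dotProduct continuous_id continuous_const
    exact (h1.add (h2.const_mul _)).add h3
  -- upper bound
  have hupper : ∀ a ∈ Ω, ∀ b ∈ Ω, F b ≤ F a
      + (∑ i, ((X.mulVec a + vtil) i - ginv i (a i)) * (b i - a i))
      + Λ / 2 * ∑ i, (b i - a i) ^ 2 := by
    intro a ha b hb
    have key := aux_taylor_s7 (fun s => ∑ i, C i (a i + s * (b i - a i)))
      (fun s => ∑ i, -ginv i (a i + s * (b i - a i)) * (b i - a i))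
      (fun s => ∑ i, -(ginv' i (a i + s * (b i - a i)) * (b i - a i)) * (b i - a i))
      (Λ * (∑ i, (b i - a i) ^ 2) - (b - a) ⬝ᵥ X.mulVec (b - a)) ?_ ?_ ?_
    · simp only [one_mul, zero_mul, add_zero, add_sub_cancel] at key
      rw [hexp a b, Finset.sum_sub_distrib]
      have h4 : (∑ i, ((X.mulVec a + vtil) i - ginv i (a i)) * (b i - a i))
        = (∑ i, (X.mulVec a + vtil) i * (b i - a i)) + ∑ i, -ginv i (a i) * (b i - a i) := by
        rw [← Finset.sum_add_distrib]
        exact Finset.sum_congr rfl fun i _ => by ring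
      rw [h4]
      linarith
    · intro s
      refine HasDerivAt.fun_sum fun i _ => ?_
      have hl : HasDerivAt (fun s : ℝ => a i + s * (b i - a i)) (b i - a i) s := by
        simpa using ((hasDerivAt_id s).mul_const (b i - a i)).const_add (a i)
      exact (hCd i _).comp s hl
    · intro s
      refine HasDerivAt.fun_sum fun i _ => ?_
      have hl : HasDerivAt (fun s : ℝ => a i + s * (b i - a i)) (b i - a i) s := by
        simpa using ((hasDerivAt_id s).mul_const (b i - a i)).const_add (a i)
      exact (((hginv_deriv i _).comp s hl).neg).mul_const _
    · intro s hs
      have hm : (fun i => a i + s * (b i - a i)) ∈ Ω := by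
        rw [hmem] at ha hb ⊢
        intro i
        obtain ⟨a1, a2⟩ := ha i
        obtain ⟨b1, b2⟩ := hb i
        constructor
        · nlinarith [mul_nonneg hs.1 (sub_nonneg.2 b1), mul_nonneg (sub_nonneg.2 hs.2) (sub_nonneg.2 a1)]
        · nlinarith [mul_nonneg hs.1 (sub_nonneg.2 b2), mul_nonneg (sub_nonneg.2 hs.2) (sub_nonneg.2 a2)]
      have h5 := hΛ _ hm (b - a)
      rw [Matrix.add_mulVec, dotProduct_add] at h5
      have h6 : (b - a) ⬝ᵥ (b - a) = ∑ i, (b i - a i) ^ 2 := by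
        simp only [dotProduct, Pi.sub_apply]
        exact Finset.sum_congr rfl fun i _ => by ring
      rw [h6] at h5
      have h7 : (b - a) ⬝ᵥ (Matrix.diagonal fun i => -ginv' i (a i + s * (b i - a i))).mulVec (b - a)
        = ∑ i, -(ginv' i (a i + s * (b i - a i)) * (b i - a i)) * (b i - a i) := by
        simp only [dotProduct, Matrix.mulVec_diagonal, Pi.sub_apply]
        exact Finset.sum_congr rfl fun i _ => by ring
      rw [h7] at h5
      linarith
  -- lower bound
  have hlower : ∀ a b, F a + (∑ i, ((X.mulVec a + vtil) i - ginv i (a i)) * (b i - a i))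
      + (1/2) * ((b - a) ⬝ᵥ X.mulVec (b - a)) ≤ F b := by
    intro a b
    rw [hexp a b]
    have : (∑ i, ((X.mulVec a + vtil) i - ginv i (a i)) * (b i - a i))
        ≤ (∑ i, (C i (b i) - C i (a i))) + ∑ i, (X.mulVec a + vtil) i * (b i - a i) := by
      rw [← Finset.sum_add_distrib]
      refine Finset.sum_le_sum fun i _ => ?_
      have := aux_convex (C i) (fun s => -ginv i s) (hCd i)
        (fun x y hxy => neg_le_neg (hginv_anti i hxy)) (b i) (a i)
      linarith
    linarith
  -- the iteration
  have hqΩ : ∀ t, q t ∈ Ω := by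
    intro t
    cases t with
    | zero => exact hq0
    | succ t =>
      rw [hmem]
      intro i
      rw [hqrec]
      exact ⟨le_max_left _ _, max_le ((hmin i).trans (hmax i)) (min_le_left _ _)⟩
  obtain ⟨c, hc⟩ : ∃ c, c = 1 / (γp * A) - Λ / 2 := ⟨_, rfl⟩
  have hcpos : 0 < c := by
    rw [hc, sub_pos, lt_div_iff₀ hγA]
    linarith
  have hdesc : ∀ t, c * ∑ i, (q (t+1) i - q t i) ^ 2 ≤ F (q t) - F (q (t+1)) := by
    intro t
    have h1 := hupper _ (hqΩ t) _ (hqΩ (t+1))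
    have h2 : (∑ i, ((X.mulVec (q t) + vtil) i - ginv i (q t i)) * (q (t+1) i - q t i))
        ≤ ∑ i, -(1 / (γp * A)) * (q (t+1) i - q t i) ^ 2 := by
      refine Finset.sum_le_sum fun i _ => ?_
      have hb := (hmem _).1 (hqΩ t) i
      have := aux_clamp_s7 (qmin i) (qmax i) (q t i) (g i ((X.mulVec (q t) + vtil) i))
        (ginv i (q t i)) ((X.mulVec (q t) + vtil) i) γp A _ _ hb.1 hb.2 hγp ?_ ?_
        (hf i _) (hqrec t i)
      · rw [← mul_le_mul_iff_left₀ hγA]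
        refine this.trans_eq ?_
        field_simp
      · intro h
        have h3 := hlip i _ _ h
        have h4 := (hg_anti i).antitone h
        rw [hgg] at h3 h4
        exact ⟨h4, h3⟩
      · intro h
        have h3 := hlip i _ _ h
        have h4 := (hg_anti i).antitone h
        rw [hgg] at h3 h4
        exact ⟨h4, h3⟩
    rw [← Finset.mul_sum] at h2
    rw [hc]
    linarith
  have hFanti : Antitone fun t => F (q t) := antitone_nat_of_succ_le fun t => by
    have h1 := hdesc t
    have h2 : 0 ≤ c * ∑ i, (q (t+1) i - q t i) ^ 2 :=
      mul_nonneg hcpos.le (Finset.sum_nonneg fun i _ => sq_nonneg _)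
    linarith
  have hbdd : BddBelow (Set.range fun t => F (q t)) := by
    refine (hcpt.bddBelow_image hFcont.continuousOn).mono ?_
    rintro _ ⟨t, rfl⟩
    exact ⟨_, hqΩ t, rfl⟩
  have hFlim := tendsto_atTop_ciInf hFanti hbdd
  have hdiff : Filter.Tendsto (fun t => F (q t) - F (q (t+1))) Filter.atTop (nhds 0) := by
    have := hFlim.sub (hFlim.comp (Filter.tendsto_add_atTop_nat 1))
    simpa using this
  have hδ : ∀ i, Filter.Tendsto (fun t => q (t+1) i - q t i) Filter.atTop (nhds 0) := by
    intro i
    have h1 : Filter.Tendsto (fun t => (q (t+1) i - q t i) ^ 2) Filter.atTop (nhds 0) := by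
      refine squeeze_zero (fun t => sq_nonneg _) (fun t => ?_)
        (by simpa using hdiff.div_const c)
      rw [le_div_iff₀ hcpos]
      have h2 := Finset.single_le_sum (f := fun i => (q (t+1) i - q t i) ^ 2)
        (fun i _ => sq_nonneg _) (Finset.mem_univ i)
      have h3 := mul_le_mul_of_nonneg_left h2 hcpos.le
      have h4 := hdesc t
      linarith
    have h5 := h1.sqrt
    simp only [Real.sqrt_sq_eq_abs, Real.sqrt_zero] at h5
    exact (tendsto_zero_iff_abs_tendsto_zero _).2 h5
  have hmulc : Continuous fun p : Fin n → ℝ => X.mulVec p + vtil :=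
    (Continuous.matrix_mulVec continuous_const continuous_id).add continuous_const
  have hgcont : ∀ i, Continuous (g i) := fun i =>
    continuous_iff_continuousAt.2 fun s => (hg_deriv i s).continuousAt
  have hfcont : ∀ i, Continuous (f i) := fun i => by
    have : f i = fun v => min (qmax i) (max (qmin i) (g i v)) := funext (hf i)
    rw [this]
    exact continuous_const.min (continuous_const.max (hgcont i))
  -- limits of subsequences are fixed points
  have hfix : ∀ x ∈ Ω, ∀ φ : ℕ → ℕ, StrictMono φ → Filter.Tendsto (q ∘ φ) Filter.atTop (nhds x) →
      ∀ i, x i = f i ((X.mulVec x + vtil) i) := by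
    intro x hx φ hφ hlim i
    have hTc : Continuous fun p : Fin n → ℝ => max (qmin i) (min (qmax i)
          (p i - γp * (p i - f i ((X.mulVec p + vtil) i)))) := by
      have h1 : Continuous fun p : Fin n → ℝ => f i ((X.mulVec p + vtil) i) :=
        (hfcont i).comp ((continuous_apply i).comp hmulc)
      have h2 : Continuous fun p : Fin n → ℝ => p i := continuous_apply i
      exact continuous_const.max (continuous_const.min
        (h2.sub (continuous_const.mul (h2.sub h1))))
    have h1 := (hTc.tendsto x).comp hlim
    have h2 := ((continuous_apply i).tendsto x).comp hlim
    have h3 := h1.sub h2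
    have h4 := (hδ i).comp hφ.tendsto_atTop
    have h5 := tendsto_nhds_unique (h4.congr fun t => by
      simp only [Function.comp_apply]; rw [hqrec]) h3
    refine aux_fixed (qmin i) (qmax i) _ γp _ ?_ ?_ hγp (by linarith)
    · rw [hf]; exact le_min ((hmin i).trans (hmax i)) (le_max_left _ _)
    · rw [hf]; exact min_le_left _ _
  -- fixed points satisfy the optimality condition
  have hopt : ∀ x, (∀ i, x i = f i ((X.mulVec x + vtil) i)) → ∀ p ∈ Ω,
      F x + (1/2) * ((p - x) ⬝ᵥ X.mulVec (p - x)) ≤ F p := by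
    intro x hx p hp
    have h1 := hlower x p
    have h2 : 0 ≤ ∑ i, ((X.mulVec x + vtil) i - ginv i (x i)) * (p i - x i) := by
      refine Finset.sum_nonneg fun i _ => ?_
      have hb := (hmem _).1 hp i
      have hxi := hx i
      rw [hf] at hxi
      generalize (X.mulVec x + vtil) i = v at hxi ⊢
      have hlh : qmin i ≤ qmax i := (hmin i).trans (hmax i)
      rcases le_total (g i v) (qmin i) with hg1 | hg1
      · rw [max_eq_left hg1, min_eq_right hlh] at hxi
        have := hginv_anti i hg1
        rw [hgg', ← hxi] at this
        exact mul_nonneg (by linarith) (by linarith)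
      · rw [max_eq_right hg1] at hxi
        rcases le_total (qmax i) (g i v) with hg2 | hg2
        · rw [min_eq_left hg2] at hxi
          have := hginv_anti i hg2
          rw [hgg', ← hxi] at this
          exact mul_nonneg_of_nonpos_of_nonpos (by linarith) (by linarith)
        · rw [min_eq_right hg2] at hxi
          rw [hxi, hgg']
          simp
    linarith
  have hpos : ∀ y : Fin n → ℝ, y ≠ 0 → 0 < y ⬝ᵥ X.mulVec y := fun y hy => by
    simpa using hXpd.dotProduct_mulVec_pos hy
  have hnn : ∀ y : Fin n → ℝ, 0 ≤ y ⬝ᵥ X.mulVec y := fun y => by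
    by_cases hy : y = 0
    · simp [hy]
    · exact (hpos y hy).le
  obtain ⟨x, hxΩ, φ, hφ, hlim⟩ := hcpt.tendsto_subseq hqΩ
  have hxo := hopt x (hfix x hxΩ φ hφ hlim)
  have hxmin : ∀ y ∈ Ω, F x ≤ F y := fun y hy => by
    have := hxo y hy
    have := hnn (y - x)
    linarith
  have huniq : ∀ p ∈ Ω, IsMinOn F Ω p → p = x := by
    intro p hp hpm
    by_contra hne
    have h1 := hpos (p - x) (sub_ne_zero.2 hne)
    have h2 := hxo p hp
    have h3 : F p ≤ F x := hpm hxΩ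
    linarith
  have hconv' : Filter.Tendsto q Filter.atTop (nhds x) := by
    refine hcpt.tendsto_nhds_of_unique_mapClusterPt (Filter.Eventually.of_forall hqΩ) ?_
    intro y hy hcl
    obtain ⟨ψ, hψ, hl⟩ := MapClusterPt.tendsto_subseq hcl
    refine huniq y hy ?_
    intro p hp
    have h1 := hopt y (hfix y hy ψ hψ hl) p hp
    have h2 := hnn (p - y)
    show F y ≤ F p
    linarith
  exact ⟨x, hxΩ, fun y hy => hxmin y hy, huniq, hconv', (hmulc.tendsto x).comp hconv'⟩
end

section
/- (Convergence of the gradient-based control D2 under condition C2) Let X be a symmetric positive definite n×n real matrix, ṽ ∈ ℝⁿ. For each i let g_i : ℝ → ℝ be a continuously differentiable strictly decreasing bijection with g_i′(v) < 0 for all v, let C_i(q) = −∫₀^q g_i⁻¹(s) ds, F(q) = Σ_i C_i(q_i) + ½ qᵀXq + qᵀṽ, and ∇²C(q) = diag(−(g_i⁻¹)′(q_i)). Suppose the stepsize γ_g > 0 satisfies γ_g · sup_{q ∈ Ω} λ_max(∇²C(q) + X) < 2. Then for any q(0) ∈ Ω, the projected-gradient iterates q(t+1) = clamp_Ω(q(t)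 − γ_g ∇F(q(t))), where ∇F(q) = −g⁻¹(q) + Xq + ṽ componentwise, converge to the unique minimizer q* of F over Ω. -/
open Matrix

lemma aux_mvt (f f' : ℝ → ℝ) (hf : ∀ s, HasDerivAt f (f' s) s) (l u a b : ℝ)
    (ha : a ∈ Set.Icc l u) (hb : b ∈ Set.Icc l u) :
    ∃ ξ ∈ Set.Icc l u, f b - f a = f' ξ * (b - a) := by
  have hc : Continuous f := continuous_iff_continuousAt.2 fun s => (hf s).continuousAt
  rcases lt_trichotomy a b with h | h | h
  · obtain ⟨c, hc1, hc2⟩ := exists_hasDerivAt_eq_slope f f' h hc.continuousOn (fun x _ => hf x)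
    refine ⟨c, ⟨ha.1.trans hc1.1.le, hc1.2.le.trans hb.2⟩, ?_⟩
    rw [hc2, div_mul_cancel₀ _ (by linarith)]
  · exact ⟨a, ha, by subst h; simp⟩
  · obtain ⟨c, hc1, hc2⟩ := exists_hasDerivAt_eq_slope f f' h hc.continuousOn (fun x _ => hf x)
    refine ⟨c, ⟨hb.1.trans hc1.1.le, hc1.2.le.trans ha.2⟩, ?_⟩
    have : f' c * (a - b) = f a - f b := by rw [hc2, div_mul_cancel₀ _ (by linarith)]
    linarith

lemma aux_pd {n : ℕ} (hn : 0 < n) (X : Matrix (Fin n) (Fin n) ℝ) (hX : X.PosDef) :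
    ∃ m : ℝ, 0 < m ∧ ∀ x : Fin n → ℝ, m * (x ⬝ᵥ x) ≤ x ⬝ᵥ X.mulVec x := by
  have : Nonempty (Fin n) := ⟨⟨0, hn⟩⟩
  have hcont : Continuous fun x : Fin n → ℝ => x ⬝ᵥ X.mulVec x := by fun_prop
  have hne : (Metric.sphere (0 : Fin n → ℝ) 1).Nonempty :=
    NormedSpace.sphere_nonempty.2 zero_le_one
  obtain ⟨z, hz, hmin⟩ := (isCompact_sphere (0 : Fin n → ℝ) 1).exists_isMinOn hne hcont.continuousOn
  have hz1 : ‖z‖ = 1 := by simpa using hz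
  have hz0 : z ≠ 0 := by rintro rfl; simp at hz1
  have hpos : 0 < z ⬝ᵥ X.mulVec z := by simpa using hX.dotProduct_mulVec_pos hz0
  set c := z ⬝ᵥ X.mulVec z with hc
  have hn' : (0:ℝ) < n := by exact_mod_cast hn
  refine ⟨c / n, by positivity, fun x => ?_⟩
  have h1 : x ⬝ᵥ x ≤ n * ‖x‖ ^ 2 := by
    have : ∀ i ∈ Finset.univ, x i * x i ≤ ‖x‖ ^ 2 := fun i _ => by
      have := norm_le_pi_norm x i
      rw [Real.norm_eq_abs] at this
      nlinarith [abs_mul_abs_self (x i), abs_nonneg (x i)]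
    simpa [dotProduct] using Finset.sum_le_sum this
  have h2 : c * ‖x‖ ^ 2 ≤ x ⬝ᵥ X.mulVec x := by
    by_cases hx : x = 0
    · subst hx; simp
    have hxn : 0 < ‖x‖ := norm_pos_iff.2 hx
    have hm : (‖x‖⁻¹ • x) ∈ Metric.sphere (0 : Fin n → ℝ) 1 := by
      simp [norm_smul, hxn.ne']
    have := hmin hm
    simp only [Set.mem_ofPred_eq, mulVec_smul, smul_dotProduct, dotProduct_smul, smul_eq_mul] at this
    have h3 : (x ⬝ᵥ X.mulVec x) = ‖x‖^2 * (‖x‖⁻¹ * (‖x‖⁻¹ * (x ⬝ᵥ X.mulVec x))) := by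
      field_simp
    rw [h3]
    nlinarith [sq_nonneg ‖x‖]
  calc c / n * (x ⬝ᵥ x) ≤ c / n * (n * ‖x‖ ^ 2) := by gcongr
    _ = c * ‖x‖ ^ 2 := by field_simp
    _ ≤ _ := h2

lemma aux_coc {n : ℕ} (H : Matrix (Fin n) (Fin n) ℝ) (hH : H.IsSymm) (L : ℝ) (hL : 0 < L)
    (h0 : ∀ x : Fin n → ℝ, 0 ≤ x ⬝ᵥ H.mulVec x)
    (h1 : ∀ x : Fin n → ℝ, x ⬝ᵥ H.mulVec x ≤ L * (x ⬝ᵥ x)) (x : Fin n → ℝ) :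
    H.mulVec x ⬝ᵥ H.mulVec x ≤ L * (x ⬝ᵥ H.mulVec x) := by
  set y := H.mulVec x with hy
  have ha := h0 (x - L⁻¹ • y)
  have hs : x ⬝ᵥ H.mulVec y = y ⬝ᵥ y := by
    rw [dotProduct_mulVec, ← mulVec_transpose, hH.eq]
  have hb := h1 y
  simp only [mulVec_sub, mulVec_smul, sub_dotProduct, dotProduct_sub, smul_dotProduct,
    dotProduct_smul, smul_eq_mul, hs, ← hy] at ha
  have hi : 0 < L⁻¹ := by positivity
  have : L⁻¹ * (L⁻¹ * (y ⬝ᵥ H.mulVec y)) ≤ L⁻¹ * (L⁻¹ * (L * (y ⬝ᵥ y))) := by gcongr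
  have e : L⁻¹ * (L⁻¹ * (L * (y ⬝ᵥ y))) = L⁻¹ * (y ⬝ᵥ y) := by field_simp
  have h2 : L⁻¹ * (y ⬝ᵥ y) ≤ x ⬝ᵥ y := by linarith
  have h3 : L * (L⁻¹ * (y ⬝ᵥ y)) ≤ L * (x ⬝ᵥ y) := by gcongr
  rwa [← mul_assoc, mul_inv_cancel₀ hL.ne', one_mul] at h3

lemma aux_clamp_s10 (l u a b : ℝ) :
    (max l (min u a) - max l (min u b)) ^ 2 ≤ (a - b) ^ 2 := by
  rw [sq_le_sq]
  calc |max l (min u a) - max l (min u b)| ≤ |min u a - min u b| := by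
        simpa using abs_max_sub_max_le_max l (min u a) l (min u b)
    _ ≤ |a - b| := by
        simpa using abs_min_sub_min_le_max u a u b

lemma aux_fix (l u p G γ : ℝ) (hγ : 0 < γ) (hp : p ∈ Set.Icc l u)
    (h : ∀ y ∈ Set.Icc l u, 0 ≤ (y - p) * G) : p = max l (min u (p - γ * G)) := by
  obtain ⟨h1, h2⟩ := hp
  have hl := h l ⟨le_rfl, h1.trans h2⟩
  have hu := h u ⟨h1.trans h2, le_rfl⟩
  rcases lt_trichotomy G 0 with hG | hG | hG
  · have : p = u := le_antisymm h2 (by nlinarith)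
    subst this
    rw [min_eq_left (by nlinarith), max_eq_right h1]
  · subst hG; simp [h1, h2]
  · have : p = l := le_antisymm (by nlinarith) h1
    subst this
    rw [max_eq_left]
    exact (min_le_right _ _).trans (by nlinarith)

lemma aux_deriv_nonneg (φ : ℝ → ℝ) (d : ℝ) (h : HasDerivAt φ d 0)
    (hm : ∀ s ∈ Set.Ioc (0:ℝ) 1, φ 0 ≤ φ s) : 0 ≤ d := by
  have ht := (hasDerivAt_iff_tendsto_slope.1 h).mono_left
    (nhdsWithin_mono 0 (show Set.Ioi (0:ℝ) ⊆ {0}ᶜ from fun x hx => by simpa using (ne_of_gt hx)))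
  refine ge_of_tendsto ht ?_
  filter_upwards [Ioc_mem_nhdsGT (zero_lt_one (α := ℝ))] with s hs
  rw [slope_def_field]
  exact div_nonneg (sub_nonneg.2 (hm s hs)) (by simpa using hs.1.le)

/-- Convergence of the gradient-based control `D2` under condition C2:
if `γ_g · sup_{q∈Ω} λ_max(∇²C(q) + X) < 2`, the projected-gradient iterates
`q(t+1) = clamp_Ω(q(t) − γ_g ∇F(q(t)))` converge to the unique minimizer of
`F` over `Ω`. -/
theorem stmt_10 (n : ℕ) (hn : 0 < n)
    (X : Matrix (Fin n) (Fin n) ℝ) (hXsym : X.IsSymm) (hXpd : X.PosDef)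
    (vtil : Fin n → ℝ)
    (qmin qmax : Fin n → ℝ) (hmin : ∀ i, qmin i ≤ 0) (hmax : ∀ i, 0 ≤ qmax i)
    (g g' ginv ginv' : Fin n → ℝ → ℝ)
    (hg_deriv : ∀ i v, HasDerivAt (g i) (g' i v) v)
    (hg'_cont : ∀ i, Continuous (g' i))
    (hg'_neg : ∀ i v, g' i v < 0)
    (hg_anti : ∀ i, StrictAnti (g i))
    (hg_bij : ∀ i, Function.Bijective (g i))
    (hginv : ∀ i, Function.LeftInverse (ginv i) (g i) ∧ Function.RightInverse (ginv i) (g i))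
    (hginv_deriv : ∀ i s, HasDerivAt (ginv i) (ginv' i s) s)
    (C : Fin n → ℝ → ℝ)
    (hC : ∀ i q, C i q = -∫ s in (0:ℝ)..q, ginv i s)
    (F : (Fin n → ℝ) → ℝ)
    (hF : ∀ q, F q = (∑ i, C i (q i)) + (1/2) * (q ⬝ᵥ X.mulVec q) + q ⬝ᵥ vtil)
    (Ω : Set (Fin n → ℝ))
    (hΩ : Ω = Set.univ.pi fun i => Set.Icc (qmin i) (qmax i))
    (γg : ℝ) (hγg : 0 < γg)
    (Λ : ℝ)
    (hΛ : ∀ q ∈ Ω, ∀ x : Fin n → ℝ,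
      x ⬝ᵥ ((Matrix.diagonal (fun i => -(ginv' i (q i))) + X).mulVec x) ≤ Λ * (x ⬝ᵥ x))
    (hC2 : γg * Λ < 2)
    (q : ℕ → Fin n → ℝ) (hq0 : q 0 ∈ Ω)
    (hqrec : ∀ t, ∀ i, q (t+1) i
      = max (qmin i) (min (qmax i)
          (q t i - γg * (-(ginv i (q t i)) + (X.mulVec (q t) + vtil) i)))) :
    ∃ qstar, qstar ∈ Ω ∧ IsMinOn F Ω qstar ∧
      (∀ p ∈ Ω, IsMinOn F Ω p → p = qstar) ∧
      Filter.Tendsto q Filter.atTop (nhds qstar) := by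
  have hgc : ∀ i, Continuous (ginv i) := fun i =>
    continuous_iff_continuousAt.2 fun s => (hginv_deriv i s).continuousAt
  have hganti : ∀ i, Antitone (ginv i) := fun i a b hab => by
    by_contra! hlt
    have := hg_anti i hlt
    rw [(hginv i).2 a, (hginv i).2 b] at this
    linarith
  have hgneg : ∀ i s, ginv' i s ≤ 0 := fun i s => by
    rw [← (hginv_deriv i s).deriv]
    exact (hganti i).deriv_nonpos
  have hCd : ∀ i s, HasDerivAt (C i) (-(ginv i s)) s := fun i s => by
    have : C i = fun q => -∫ s in (0:ℝ)..q, ginv i s := funext (hC i)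
    rw [this]
    exact (intervalIntegral.integral_hasDerivAt_right ((hgc i).intervalIntegrable _ _)
      ((hgc i).stronglyMeasurableAtFilter _ _) (hgc i).continuousAt).neg
  have hCc : ∀ i, Continuous (C i) := fun i =>
    continuous_iff_continuousAt.2 fun s => (hCd i s).continuousAt
  have hFc : Continuous F := by
    rw [show F = fun q => (∑ i, C i (q i)) + (1/2) * (q ⬝ᵥ X.mulVec q) + q ⬝ᵥ vtil from funext hF]
    fun_prop
  have hΩm : ∀ p, p ∈ Ω ↔ ∀ i, p i ∈ Set.Icc (qmin i) (qmax i) := fun p => by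
    rw [hΩ]; simp only [Set.mem_univ_pi]
  have hΩc : IsCompact Ω := by
    rw [hΩ]; exact isCompact_univ_pi fun i => isCompact_Icc
  have hlu : ∀ i, qmin i ≤ qmax i := fun i => (hmin i).trans (hmax i)
  obtain ⟨m, hm0, hm⟩ := aux_pd hn X hXpd
  -- the variational inequality
  have hVI : ∀ p ∈ Ω, IsMinOn F Ω p → ∀ y ∈ Ω,
      0 ≤ ∑ j, (y j - p j) * (-(ginv j (p j)) + (X.mulVec p + vtil) j) := by
    intro p hp hpm y hy
    have hXs : ∀ w : Fin n → ℝ, w ⬝ᵥ X.mulVec p = p ⬝ᵥ X.mulVec w := fun w => by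
      rw [dotProduct_mulVec, ← mulVec_transpose, hXsym.eq, dotProduct_comm]
    set w := y - p with hw
    refine aux_deriv_nonneg (fun s => F (p + s • w)) _ ?_ ?_
    · have h1 : ∀ j, HasDerivAt (fun s : ℝ => C j (p j + s * w j)) (-(ginv j (p j)) * w j) 0 := by
        intro j
        have hin : HasDerivAt (fun s : ℝ => p j + s * w j) (w j) 0 := by
          simpa using ((hasDerivAt_id (0:ℝ)).mul_const (w j)).const_add (p j)
        have hout : HasDerivAt (C j) (-(ginv j (p j))) (p j + 0 * w j) := by
          simpa using hCd j (p j)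
        exact hout.comp (0:ℝ) hin
      have h2 := HasDerivAt.fun_sum (u := Finset.univ) fun j _ => h1 j
      have h3 : HasDerivAt (fun s : ℝ => (1/2) * (p ⬝ᵥ X.mulVec p) + p ⬝ᵥ vtil
          + s * (w ⬝ᵥ X.mulVec p + w ⬝ᵥ vtil) + s ^ 2 * ((1/2) * (w ⬝ᵥ X.mulVec w)))
          (w ⬝ᵥ X.mulVec p + w ⬝ᵥ vtil) 0 := by
        have ha := ((hasDerivAt_id (0:ℝ)).mul_const (w ⬝ᵥ X.mulVec p + w ⬝ᵥ vtil)).const_add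
          ((1/2) * (p ⬝ᵥ X.mulVec p) + p ⬝ᵥ vtil)
        have hb := (hasDerivAt_pow 2 (0:ℝ)).mul_const ((1/2) * (w ⬝ᵥ X.mulVec w))
        exact (ha.fun_add hb).congr_deriv (by simp)
      have h4 := h2.fun_add h3
      have e : (fun s : ℝ => F (p + s • w)) = fun s : ℝ => (∑ j, C j (p j + s * w j)) +
          ((1/2) * (p ⬝ᵥ X.mulVec p) + p ⬝ᵥ vtil
          + s * (w ⬝ᵥ X.mulVec p + w ⬝ᵥ vtil) + s ^ 2 * ((1/2) * (w ⬝ᵥ X.mulVec w))) := by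
        funext s
        simp only [hF, Pi.add_apply, Pi.smul_apply, smul_eq_mul, mulVec_add, mulVec_smul, add_dotProduct,
          dotProduct_add, smul_dotProduct, dotProduct_smul, hXs w]
        ring
      rw [e]
      refine h4.congr_deriv ?_
      · simp only [dotProduct, ← Finset.sum_add_distrib]
        refine Finset.sum_congr rfl fun j _ => ?_
        simp only [hw, Pi.sub_apply, Pi.add_apply]
        ring
    · intro s hs
      have hmem : p + s • w ∈ Ω := by
        rw [hΩm] at hp hy ⊢
        intro i
        obtain ⟨a1, a2⟩ := hp i
        obtain ⟨b1, b2⟩ := hy i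
        obtain ⟨s1, s2⟩ := hs
        simp only [hw, Pi.add_apply, Pi.smul_apply, Pi.sub_apply, smul_eq_mul]
        constructor <;> nlinarith
      simpa using hpm hmem
  have hfix : ∀ p ∈ Ω, IsMinOn F Ω p → ∀ i, p i = max (qmin i) (min (qmax i)
      (p i - γg * (-(ginv i (p i)) + (X.mulVec p + vtil) i))) := by
    intro p hp hpm i
    refine aux_fix _ _ _ _ _ hγg ((hΩm p).1 hp i) fun y hy => ?_
    have hmem : Function.update p i y ∈ Ω := by
      rw [hΩm] at hp ⊢
      intro j
      by_cases hj : j = i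
      · subst hj; simpa using hy
      · simpa [hj] using hp j
    have := hVI p hp hpm _ hmem
    rw [Finset.sum_eq_single i] at this
    · simpa using this
    · intro j _ hj; simp [hj]
    · simp
  -- contraction
  have hzero : (0 : Fin n → ℝ) ∈ Ω := by
    rw [hΩm]; exact fun i => ⟨hmin i, hmax i⟩
  have hlow : ∀ ξ : Fin n → ℝ, ∀ x : Fin n → ℝ, m * (x ⬝ᵥ x) ≤
      x ⬝ᵥ ((Matrix.diagonal (fun i => -(ginv' i (ξ i))) + X).mulVec x) := by
    intro ξ x
    rw [add_mulVec, dotProduct_add]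
    have : 0 ≤ x ⬝ᵥ (Matrix.diagonal (fun i => -(ginv' i (ξ i)))).mulVec x := by
      simp only [dotProduct, mulVec_diagonal]
      refine Finset.sum_nonneg fun i _ => ?_
      nlinarith [hgneg i (ξ i), mul_self_nonneg (x i)]
    linarith [hm x]
  have hΛ0 : 0 < Λ := by
    have h1 := hlow 0 (fun _ => 1)
    have h2 := hΛ 0 hzero (fun _ => 1)
    have h3 : (0:ℝ) < (fun _ : Fin n => (1:ℝ)) ⬝ᵥ (fun _ => 1) := by
      simpa [dotProduct] using hn
    have h4 := h1.trans h2
    exact hm0.trans_le (le_of_mul_le_mul_right h4 h3)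
  have hcontr : ∀ a ∈ Ω, ∀ b ∈ Ω,
      ∑ i, (max (qmin i) (min (qmax i) (a i - γg * (-(ginv i (a i)) + (X.mulVec a + vtil) i)))
        - max (qmin i) (min (qmax i) (b i - γg * (-(ginv i (b i)) + (X.mulVec b + vtil) i)))) ^ 2
      ≤ (1 - γg * (2 - γg * Λ) * m) * ∑ i, (a i - b i) ^ 2 := by
    intro a ha b hb
    have hx := fun i => aux_mvt (ginv i) (ginv' i) (hginv_deriv i) (qmin i) (qmax i) (b i) (a i)
      ((hΩm b).1 hb i) ((hΩm a).1 ha i)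
    choose ξ hξ1 hξ2 using hx
    have hξ : ξ ∈ Ω := (hΩm ξ).2 hξ1
    set H := Matrix.diagonal (fun i => -(ginv' i (ξ i))) + X with hH
    have hHs : H.IsSymm := (Matrix.isSymm_diagonal _).add hXsym
    set x := a - b with hxdef
    have hxx : ∑ i, (a i - b i) ^ 2 = x ⬝ᵥ x := by
      simp only [dotProduct, hxdef, Pi.sub_apply, sq]
    have hxx0 : 0 ≤ x ⬝ᵥ x := by rw [← hxx]; positivity
    have hl := hlow ξ
    have hnn : ∀ z : Fin n → ℝ, 0 ≤ z ⬝ᵥ z := fun z =>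
      Finset.sum_nonneg fun i _ => mul_self_nonneg _
    have hcoc := aux_coc H hHs Λ hΛ0 (fun z => (mul_nonneg hm0.le (hnn z)).trans (hl z))
      (hΛ ξ hξ) x
    calc _ ≤ ∑ i, ((a i - γg * (-(ginv i (a i)) + (X.mulVec a + vtil) i))
            - (b i - γg * (-(ginv i (b i)) + (X.mulVec b + vtil) i))) ^ 2 :=
          Finset.sum_le_sum fun i _ => aux_clamp_s10 _ _ _ _
      _ = (x - γg • H.mulVec x) ⬝ᵥ (x - γg • H.mulVec x) := by
          simp only [dotProduct, ← sq]
          refine Finset.sum_congr rfl fun i _ => ?_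
          congr 1
          simp only [hH, hxdef, add_mulVec, mulVec_sub, mulVec_diagonal, Pi.sub_apply, Pi.add_apply,
            Pi.smul_apply, smul_eq_mul]
          linear_combination γg * hξ2 i
      _ = x ⬝ᵥ x - 2 * γg * (x ⬝ᵥ H.mulVec x) + γg ^ 2 * (H.mulVec x ⬝ᵥ H.mulVec x) := by
          simp only [sub_dotProduct, dotProduct_sub, smul_dotProduct, dotProduct_smul, smul_eq_mul,
            dotProduct_comm (H.mulVec x) x]
          ring
      _ ≤ x ⬝ᵥ x - 2 * γg * (x ⬝ᵥ H.mulVec x) + γg ^ 2 * (Λ * (x ⬝ᵥ H.mulVec x)) := by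
          gcongr
      _ = x ⬝ᵥ x - γg * (2 - γg * Λ) * (x ⬝ᵥ H.mulVec x) := by ring
      _ ≤ x ⬝ᵥ x - γg * (2 - γg * Λ) * (m * (x ⬝ᵥ x)) := by
          have : 0 ≤ γg * (2 - γg * Λ) := mul_nonneg hγg.le (by linarith)
          have := mul_le_mul_of_nonneg_left (hl x) this
          linarith
      _ = _ := by rw [hxx]; ring
  set ρ := 1 - γg * (2 - γg * Λ) * m with hρ
  have hρ1 : ρ < 1 := by
    have : 0 < γg * (2 - γg * Λ) * m := mul_pos (mul_pos hγg (by linarith)) hm0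
    linarith
  obtain ⟨qs, hqs, hqsm⟩ := hΩc.exists_isMinOn ⟨0, hzero⟩ hFc.continuousOn
  refine ⟨qs, hqs, hqsm, ?_, ?_⟩
  · intro p hp hpm
    have h := hcontr p hp qs hqs
    simp only [← hfix p hp hpm, ← hfix qs hqs hqsm] at h
    have h0 : 0 ≤ ∑ i, (p i - qs i) ^ 2 := by positivity
    have h1 : ∑ i, (p i - qs i) ^ 2 = 0 := by nlinarith
    rw [Finset.sum_eq_zero_iff_of_nonneg (fun i _ => sq_nonneg _)] at h1
    funext i
    have := h1 i (Finset.mem_univ i)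
    exact sub_eq_zero.1 (pow_eq_zero_iff (two_ne_zero) |>.1 this)
  · have hqΩ : ∀ t, q t ∈ Ω := by
      intro t
      cases t with
      | zero => exact hq0
      | succ t =>
        rw [hΩm]
        intro i
        rw [hqrec]
        exact ⟨le_max_left _ _, max_le (hlu i) (min_le_left _ _)⟩
    have hstep : ∀ t, ∑ i, (q (t+1) i - qs i) ^ 2 ≤ max ρ 0 * ∑ i, (q t i - qs i) ^ 2 := by
      intro t
      have h := hcontr (q t) (hqΩ t) qs hqs
      simp only [← hfix qs hqs hqsm, ← hqrec] at h
      refine h.trans ?_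
      gcongr
      exact le_max_left _ _
    have hpow : ∀ t, ∑ i, (q t i - qs i) ^ 2 ≤ (max ρ 0) ^ t * ∑ i, (q 0 i - qs i) ^ 2 := by
      intro t
      induction t with
      | zero => simp
      | succ t ih =>
        refine (hstep t).trans ?_
        rw [pow_succ', mul_assoc]
        exact mul_le_mul_of_nonneg_left ih (le_max_right _ _)
    have hlim : Filter.Tendsto (fun t : ℕ => (max ρ 0) ^ t * ∑ i, (q 0 i - qs i) ^ 2)
        Filter.atTop (nhds 0) := by
      simpa using (tendsto_pow_atTop_nhds_zero_of_lt_one (le_max_right ρ 0)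
        (max_lt hρ1 zero_lt_one)).mul_const (∑ i, (q 0 i - qs i) ^ 2)
    rw [tendsto_pi_nhds]
    intro i
    have hsq : Filter.Tendsto (fun t => (q t i - qs i) ^ 2) Filter.atTop (nhds 0) := by
      refine squeeze_zero (fun t => sq_nonneg _) (fun t => ?_) hlim
      exact (Finset.single_le_sum (f := fun i => (q t i - qs i) ^ 2)
        (fun j _ => sq_nonneg _) (Finset.mem_univ i)).trans (hpow t)
    have habs : Filter.Tendsto (fun t => |q t i - qs i|) Filter.atTop (nhds 0) := by
      have := hsq.sqrt
      simpa [Real.sqrt_sq_eq_abs] using this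
    rw [tendsto_iff_dist_tendsto_zero]
    simpa [Real.dist_eq] using habs
end

section
/- (Equilibrium equivalence of D1 and D2) Let X be a symmetric positive definite n×n real matrix, ṽ ∈ ℝⁿ. For each i let g_i : ℝ → ℝ be a continuous strictly decreasing bijection, f_i(v) = min(q_i^max, max(q_i^min, g_i(v))), C_i(q) = −∫₀^q g_i⁻¹(s) ds, and F(q) = Σ_i C_i(q_i) + ½ qᵀXq + qᵀṽ, so that ∇F(q)_i = −g_i⁻¹(q_i) + (Xq + ṽ)_i. Then for any γ_g > 0, a point q* ∈ Ω satisfies q* = clamp_Ω(q* − γ_g ∇F(q*)) if and only if q* = f(Xq* + ṽ); in particular the non-incremental dynamics and the projected-gradient dynamics have the same unique equilibrium. -/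
open Matrix

theorem aux_deriv (φ : ℝ → ℝ) (d δ : ℝ) (hδ : 0 < δ) (h : HasDerivAt φ d 0)
    (hm : ∀ s, 0 < s → s ≤ δ → φ 0 ≤ φ s) : 0 ≤ d := by
  have h1 := (hasDerivWithinAt_iff_tendsto_slope' (s := Set.Ioi (0:ℝ)) (by simp)).1
    (h.hasDerivWithinAt (s := Set.Ioi (0:ℝ)))
  refine ge_of_tendsto h1 ?_
  filter_upwards [Ioc_mem_nhdsGT hδ] with s hs
  rw [slope_def_field]
  have := hm s hs.1 hs.2
  exact div_nonneg (by linarith) (by linarith [hs.1])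

theorem aux_clamp_s11 (a b x y : ℝ) (hx : a ≤ x) (hx' : x ≤ b) :
    x = min b (max a y) ↔ (x < b → y ≤ x) ∧ (a < x → x ≤ y) := by
  grind

theorem aux_clamp2 (a b x y : ℝ) (hx : a ≤ x) (hx' : x ≤ b) :
    x = max a (min b y) ↔ (x < b → y ≤ x) ∧ (a < x → x ≤ y) := by
  grind

theorem aux_exists (n : ℕ)
    (X : Matrix (Fin n) (Fin n) ℝ) (hXsym : X.IsSymm)
    (v a b : Fin n → ℝ) (hab : ∀ i, a i ≤ b i)
    (c : Fin n → ℝ → ℝ) (hc : ∀ i, Continuous (c i)) :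
    ∃ q : Fin n → ℝ, (∀ i, a i ≤ q i ∧ q i ≤ b i) ∧
      ∀ i, (q i < b i → 0 ≤ -(c i (q i)) + (X.mulVec q + v) i) ∧
        (a i < q i → -(c i (q i)) + (X.mulVec q + v) i ≤ 0) := by
  let C : Fin n → ℝ → ℝ := fun i t => ∫ s in (0:ℝ)..t, c i s
  have hC : ∀ i t, HasDerivAt (C i) (c i t) t := fun i t =>
    (hc i).integral_hasStrictDerivAt 0 t |>.hasDerivAt
  have hCc : ∀ i, Continuous (C i) := fun i =>
    continuous_iff_continuousAt.2 fun t => (hC i t).continuousAt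
  let F : (Fin n → ℝ) → ℝ := fun q => (∑ i, -(C i (q i))) + (1/2) * (q ⬝ᵥ X.mulVec q) + q ⬝ᵥ v
  have hF : Continuous F := by
    have h1 : Continuous fun q : Fin n → ℝ => ∑ i, -(C i (q i)) :=
      continuous_finsetSum _ fun i _ => ((hCc i).comp (continuous_apply i)).neg
    have h2 : Continuous fun q : Fin n → ℝ => q ⬝ᵥ X.mulVec q :=
      continuous_id.dotProduct (continuous_const.matrix_mulVec continuous_id)
    have h3 : Continuous fun q : Fin n → ℝ => q ⬝ᵥ v :=
      continuous_id.dotProduct continuous_const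
    exact (h1.add (continuous_const.mul h2)).add h3
  have hK : IsCompact (Set.univ.pi fun i => Set.Icc (a i) (b i)) :=
    isCompact_univ_pi fun i => isCompact_Icc
  obtain ⟨q, hq, hmin⟩ := hK.exists_isMinOn ⟨a, fun i _ => ⟨le_rfl, hab i⟩⟩ hF.continuousOn
  have hq' : ∀ i, a i ≤ q i ∧ q i ≤ b i := fun i => hq i (Set.mem_univ i)
  refine ⟨q, hq', fun i => ?_⟩
  let φ : ℝ → ℝ := fun s => -(C i (q i + s)) + s * (X.mulVec q + v) i + (1/2) * s^2 * X i i
  have hexp : ∀ s, F (q + Pi.single i s) - F q = φ s - φ 0 := by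
    intro s
    have e1 : (∑ j, -(C j ((q + Pi.single i s : Fin n → ℝ) j))) - ∑ j, -(C j (q j))
        = -(C i (q i + s)) + C i (q i) := by
      rw [← Finset.sum_sub_distrib, Finset.sum_eq_single i]
      · simp
      · intro j _ hj
        simp [hj]
      · simp
    have e2 : q ⬝ᵥ X.mulVec (Pi.single i s) = s * (X.mulVec q) i := by
      rw [Matrix.dotProduct_mulVec, ← Matrix.mulVec_transpose, hXsym.eq]
      simp [mul_comm]
    have e3 : (Pi.single i s : Fin n → ℝ) ⬝ᵥ X.mulVec (Pi.single i s) = s^2 * X i i := by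
      simp [Matrix.mulVec_single]
      ring
    have e4 : (q + Pi.single i s) ⬝ᵥ X.mulVec (q + Pi.single i s)
        = q ⬝ᵥ X.mulVec q + 2 * (s * (X.mulVec q) i) + s^2 * X i i := by
      rw [Matrix.mulVec_add, add_dotProduct, dotProduct_add, dotProduct_add, e2, e3,
        single_dotProduct]
      ring
    have e5 : (q + Pi.single i s) ⬝ᵥ v = q ⬝ᵥ v + s * v i := by
      rw [add_dotProduct, single_dotProduct]
    simp only [F, φ, e4, e5, Pi.add_apply, add_zero] at e1 ⊢
    linear_combination e1
  have hle : ∀ s, a i ≤ q i + s → q i + s ≤ b i → φ 0 ≤ φ s := by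
    intro s h1 h2
    have : F q ≤ F (q + Pi.single i s) := by
      apply hmin
      intro j _
      by_cases hj : j = i
      · subst hj
        simpa using ⟨h1, h2⟩
      · simpa [hj] using hq' j
    linarith [hexp s]
  have hd : HasDerivAt φ (-(c i (q i)) + (X.mulVec q + v) i) 0 := by
    have h1 : HasDerivAt (fun s => C i (q i + s)) (c i (q i)) 0 := by
      have := (hC i (q i + 0)).comp_const_add (q i) 0
      simpa using this
    have h2 : HasDerivAt (fun s : ℝ => s * (X.mulVec q + v) i) ((X.mulVec q + v) i) 0 := by
      simpa using (hasDerivAt_id (0:ℝ)).mul_const ((X.mulVec q + v) i)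
    have h3 : HasDerivAt (fun s : ℝ => (1/2) * s^2 * X i i) 0 0 := by
      have h := (((hasDerivAt_id (0:ℝ)).pow 2).const_mul (1/2)).mul_const (X i i)
      have e : (1/2 : ℝ) * (((2:ℕ):ℝ) * id (0:ℝ) ^ (2-1) * 1) * X i i = 0 := by simp
      rw [e] at h
      exact h
    have := (h1.neg.add h2).add h3
    rw [add_zero] at this
    exact this
  constructor
  · intro h
    exact aux_deriv φ _ (b i - q i) (by linarith) hd fun s h1 h2 =>
      hle s (by linarith [(hq' i).1]) (by linarith)
  · intro h
    have hd' : HasDerivAt (fun s => φ (-s)) (-(-(c i (q i)) + (X.mulVec q + v) i)) 0 := by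
      have hd0 : HasDerivAt φ (-(c i (q i)) + (X.mulVec q + v) i) (-(0:ℝ)) := by
        rw [neg_zero]; exact hd
      have := HasDerivAt.comp (0:ℝ) hd0 (hasDerivAt_neg (0:ℝ))
      rw [mul_neg_one] at this
      exact this
    have := aux_deriv (fun s => φ (-s)) _ (q i - a i) (by linarith) hd' fun s h1 h2 => by
      simpa using hle (-s) (by linarith) (by linarith [(hq' i).2])
    linarith

/-- Equilibrium equivalence of `D1` and `D2`: for any stepsize `γ_g > 0`,
a point `q* ∈ Ω` is a fixed point of the projected-gradient map
`q ↦ clamp_Ω(q − γ_g ∇F(q))` iff `q* = f(Xq* + ṽ)`; in particular the two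
dynamics share the same unique equilibrium. -/
theorem stmt_11 (n : ℕ) (hn : 0 < n)
    (X : Matrix (Fin n) (Fin n) ℝ) (hXsym : X.IsSymm) (hXpd : X.PosDef)
    (vtil : Fin n → ℝ)
    (qmin qmax : Fin n → ℝ) (hmin : ∀ i, qmin i ≤ 0) (hmax : ∀ i, 0 ≤ qmax i)
    (g ginv : Fin n → ℝ → ℝ)
    (hg_cont : ∀ i, Continuous (g i))
    (hg_anti : ∀ i, StrictAnti (g i))
    (hg_bij : ∀ i, Function.Bijective (g i))
    (hginv : ∀ i, Function.LeftInverse (ginv i) (g i) ∧ Function.RightInverse (ginv i) (g i))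
    (f : Fin n → ℝ → ℝ)
    (hf : ∀ i v, f i v = min (qmax i) (max (qmin i) (g i v)))
    (Ω : Set (Fin n → ℝ))
    (hΩ : Ω = Set.univ.pi fun i => Set.Icc (qmin i) (qmax i))
    (gradF : (Fin n → ℝ) → (Fin n → ℝ))
    (hgradF : ∀ q i, gradF q i = -(ginv i (q i)) + (X.mulVec q + vtil) i) :
    (∀ γg : ℝ, 0 < γg → ∀ qs ∈ Ω,
      ((∀ i, qs i = max (qmin i) (min (qmax i) (qs i - γg * gradF qs i))) ↔
        (∀ i, qs i = f i ((X.mulVec qs + vtil) i)))) ∧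
    (∃! qs, qs ∈ Ω ∧ ∀ i, qs i = f i ((X.mulVec qs + vtil) i)) := by
  have key : ∀ i x w, (ginv i x ≤ w ↔ g i w ≤ x) ∧ (w ≤ ginv i x ↔ x ≤ g i w) := by
    intro i x w
    have hx := (hginv i).2 x
    constructor
    · rw [← (hg_anti i).le_iff_ge, hx]
    · rw [← (hg_anti i).le_iff_ge, hx]
  have hcont : ∀ i, Continuous (ginv i) := by
    intro i
    have hm : Monotone (fun x => -(ginv i x)) := by
      intro x y hxy
      have : ginv i y ≤ ginv i x := by
        rw [(key i y _).1, (hginv i).2 x]; exact hxy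
      simpa using this
    have hs : Function.Surjective (fun x => -(ginv i x)) := fun y =>
      ⟨g i (-y), by simp [(hginv i).1 (-y)]⟩
    have h := (hm.continuous_of_surjective hs).neg
    have e : (-fun x => -(ginv i x)) = ginv i := by funext x; simp
    first
      | exact e ▸ h
      | exact (continuous_neg_iff.1 (hm.continuous_of_surjective hs))
  have hmem : ∀ q, q ∈ Ω ↔ ∀ i, qmin i ≤ q i ∧ q i ≤ qmax i := by
    intro q; rw [hΩ]; exact ⟨fun h i => h i (Set.mem_univ i), fun h i _ => h i⟩
  refine ⟨?_, ?_⟩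
  · intro γ hγ q hq
    rw [hmem] at hq
    refine forall_congr' fun i => ?_
    rw [hf, aux_clamp_s11 _ _ _ _ (hq i).1 (hq i).2, aux_clamp2 _ _ _ _ (hq i).1 (hq i).2,
      ← (key i _ _).1, ← (key i _ _).2, hgradF, sub_le_self_iff, mul_nonneg_iff_of_pos_left hγ,
      le_sub_self_iff, ← neg_nonneg (a := γ * _), ← mul_neg, mul_nonneg_iff_of_pos_left hγ]
    constructor
    · rintro ⟨h1, h2⟩
      exact ⟨fun h => by linarith [h1 h], fun h => by linarith [h2 h]⟩
    · rintro ⟨h1, h2⟩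
      exact ⟨fun h => by linarith [h1 h], fun h => by linarith [h2 h]⟩
  · obtain ⟨q, hq, hq2⟩ := aux_exists n X hXsym vtil qmin qmax
      (fun i => (hmin i).trans (hmax i)) ginv hcont
    refine ⟨q, ⟨(hmem q).2 hq, fun i => ?_⟩, ?_⟩
    · rw [hf, aux_clamp_s11 _ _ _ _ (hq i).1 (hq i).2, ← (key i _ _).1, ← (key i _ _).2]
      exact ⟨fun h => by linarith [(hq2 i).1 h], fun h => by linarith [(hq2 i).2 h]⟩
    · rintro p ⟨hp, hp2⟩
      have hq3 : ∀ i, q i = f i ((X.mulVec q + vtil) i) := fun i => by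
        rw [hf, aux_clamp_s11 _ _ _ _ (hq i).1 (hq i).2, ← (key i _ _).1, ← (key i _ _).2]
        exact ⟨fun h => by linarith [(hq2 i).1 h], fun h => by linarith [(hq2 i).2 h]⟩
      have hfa : ∀ i, Antitone (f i) := fun i x y hxy => by
        rw [hf, hf]
        exact min_le_min_left _ (max_le_max_left _ ((hg_anti i).antitone hxy))
      by_contra hne
      have hpos := hXpd.dotProduct_mulVec_pos (sub_ne_zero.2 hne)
      have hle : (p - q) ⬝ᵥ X.mulVec (p - q) ≤ 0 := by
        refine Finset.sum_nonpos fun i _ => ?_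
        have e : X.mulVec (p - q) i = (X.mulVec p + vtil) i - (X.mulVec q + vtil) i := by
          rw [Matrix.mulVec_sub]; simp
        rw [e, Pi.sub_apply]
        rcases le_total ((X.mulVec p + vtil) i) ((X.mulVec q + vtil) i) with h | h
        · have := hfa i h
          rw [← hp2, ← hq3] at this
          exact mul_nonpos_of_nonneg_of_nonpos (by linarith) (by linarith)
        · have := hfa i h
          rw [← hp2, ← hq3] at this
          exact mul_nonpos_of_nonpos_of_nonneg (by linarith) (by linarith)
      simp only [star_trivial] at hpos
      linarith
end

section
/- (Convergence of the non-incremental control D1 under condition C1) Let X be a symmetric positive definite n×n real matrix, ṽ ∈ ℝⁿ, and for each i let f_i : ℝ → ℝ be non-increasing, α_i-Lipschitz (α_i > 0), and take values in [q_i^min, q_i^max]. Suppose condition C1 holds: the matrix A⁻¹ − X is positive definite, where A⁻¹ = diag(1/α_1, …, 1/α_n). Then for any initial q(0), the iterates q(t+1) = f(Xq(t) + ṽ) converge to the unique equilibrium q* satisfying q* = f(Xq* + ṽ). -/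
open Matrix

lemma aux_eps (n : ℕ) (M : Matrix (Fin n) (Fin n) ℝ) (hM : M.PosDef) (hn : 1 ≤ n) :
    ∃ ε : ℝ, 0 < ε ∧ ∀ d : Fin n → ℝ, ε * ‖d‖ ^ 2 ≤ d ⬝ᵥ (M *ᵥ d) := by
  haveI : Nonempty (Fin n) := ⟨⟨0, hn⟩⟩
  have hpos : ∀ d : Fin n → ℝ, d ≠ 0 → 0 < d ⬝ᵥ (M *ᵥ d) := by
    intro d hd
    have := hM.dotProduct_mulVec_pos hd
    simpa using this
  have hc : Continuous fun d : Fin n → ℝ => d ⬝ᵥ (M *ᵥ d) := by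
    unfold dotProduct mulVec dotProduct
    fun_prop
  obtain ⟨x, hx, hmin⟩ := (isCompact_sphere (0 : Fin n → ℝ) 1).exists_isMinOn
    (NormedSpace.sphere_nonempty.2 zero_le_one) hc.continuousOn
  have hx0 : x ≠ 0 := by
    rintro rfl
    simp at hx
  refine ⟨_, hpos x hx0, fun d => ?_⟩
  by_cases hd : d = 0
  · subst hd; simp
  have hdn : 0 < ‖d‖ := norm_pos_iff.2 hd
  have h1 : (‖d‖⁻¹ • d) ∈ Metric.sphere (0 : Fin n → ℝ) 1 := by
    simp [norm_smul, hdn.ne']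
  have h2 := hmin h1
  simp only [Set.mem_setOf_eq, mulVec_smul, dotProduct_smul, smul_dotProduct, smul_eq_mul] at h2
  have h3 := mul_le_mul_of_nonneg_right h2 (sq_nonneg ‖d‖)
  refine h3.trans (le_of_eq ?_)
  field_simp

lemma aux_c (n : ℕ) (hn : 1 ≤ n) (X : Matrix (Fin n) (Fin n) ℝ)
    (α : Fin n → ℝ) (hα : ∀ i, 0 < α i)
    (hC1 : ((Matrix.diagonal fun i => 1 / α i) - X).PosDef) :
    ∃ c : ℝ, 0 ≤ c ∧ c < 1 ∧ ∀ d : Fin n → ℝ, d ⬝ᵥ (X *ᵥ d) ≤ c * ∑ i, d i ^ 2 / α i := by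
  obtain ⟨ε, hε, h⟩ := aux_eps n _ hC1 hn
  set K : ℝ := 1 + ∑ i, 1 / α i with hK
  have hs : 0 ≤ ∑ i, 1 / α i := Finset.sum_nonneg fun i _ => (one_div_pos.2 (hα i)).le
  have hKpos : 0 < K := by linarith
  refine ⟨max 0 (1 - ε / K), le_max_left _ _, max_lt one_pos (by have := div_pos hε hKpos; linarith), fun d => ?_⟩
  have hV0 : 0 ≤ ∑ i, d i ^ 2 / α i := Finset.sum_nonneg fun i _ => div_nonneg (sq_nonneg _) (hα i).le
  have hV : ∑ i, d i ^ 2 / α i ≤ K * ‖d‖ ^ 2 := by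
    have : ∑ i, d i ^ 2 / α i ≤ ∑ i, (1 / α i) * ‖d‖ ^ 2 := by
      refine Finset.sum_le_sum fun i _ => ?_
      have h1 : d i ^ 2 ≤ ‖d‖ ^ 2 := by
        rw [← sq_abs]
        exact pow_le_pow_left₀ (abs_nonneg _) (norm_le_pi_norm d i) 2
      rw [div_eq_mul_one_div, mul_comm]
      exact mul_le_mul_of_nonneg_left h1 (one_div_pos.2 (hα i)).le
    rw [← Finset.sum_mul] at this
    nlinarith [sq_nonneg ‖d‖]
  have h1 := h d
  have h2 : d ⬝ᵥ (((Matrix.diagonal fun i => 1 / α i) - X) *ᵥ d) = ∑ i, d i ^ 2 / α i - d ⬝ᵥ (X *ᵥ d) := by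
    rw [sub_mulVec, dotProduct_sub]
    congr 1
    simp only [dotProduct, mulVec_diagonal]
    exact Finset.sum_congr rfl fun i _ => by ring
  rw [h2] at h1
  have h3 : ε / K * ∑ i, d i ^ 2 / α i ≤ ε * ‖d‖ ^ 2 := by
    calc _ ≤ ε / K * (K * ‖d‖ ^ 2) := mul_le_mul_of_nonneg_left hV (div_pos hε hKpos).le
      _ = _ := by field_simp
  have h4 := mul_le_mul_of_nonneg_right (le_max_right 0 (1 - ε / K)) hV0
  linarith

lemma aux_main (n : ℕ) (hn : 1 ≤ n) (X : Matrix (Fin n) (Fin n) ℝ) (hXsym : X.IsSymm)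
    (hXpd : X.PosDef) (α : Fin n → ℝ) (hα : ∀ i, 0 < α i)
    (hC1 : ((Matrix.diagonal fun i => 1 / α i) - X).PosDef) :
    ∃ c : ℝ, 0 ≤ c ∧ c < 1 ∧ ∀ d : Fin n → ℝ,
      ∑ i, α i * (X *ᵥ d) i ^ 2 ≤ c * ∑ i, d i ^ 2 / α i := by
  obtain ⟨c, hc0, hc1, h⟩ := aux_c n hn X α hα hC1
  refine ⟨c, hc0, hc1, fun d => le_trans ?_ (h d)⟩
  set w : Fin n → ℝ := fun i => α i * (X *ᵥ d) i with hw
  have hS : ∑ i, α i * (X *ᵥ d) i ^ 2 = w ⬝ᵥ (X *ᵥ d) := by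
    simp only [dotProduct, hw]
    exact Finset.sum_congr rfl fun i _ => by ring
  have hS2 : ∑ i, w i ^ 2 / α i = ∑ i, α i * (X *ᵥ d) i ^ 2 := by
    refine Finset.sum_congr rfl fun i _ => ?_
    have := (hα i).ne'
    simp only [hw]
    field_simp
  have hV0 : 0 ≤ ∑ i, w i ^ 2 / α i := Finset.sum_nonneg fun i _ => div_nonneg (sq_nonneg _) (hα i).le
  have h1 := h w
  have h2 : 0 ≤ (w - d) ⬝ᵥ (X *ᵥ (w - d)) := by
    simpa using hXpd.posSemidef.dotProduct_mulVec_nonneg (w - d)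
  have h3 : d ⬝ᵥ (X *ᵥ w) = w ⬝ᵥ (X *ᵥ d) := by
    rw [dotProduct_mulVec, ← mulVec_transpose, hXsym.eq, dotProduct_comm]
  simp only [mulVec_sub, dotProduct_sub, sub_dotProduct] at h2
  have h4 : c * ∑ i, w i ^ 2 / α i ≤ ∑ i, w i ^ 2 / α i := by nlinarith
  linarith

/-- Convergence of the non-incremental control `D1` under condition C1:
if `A⁻¹ − X ≻ 0` with `A⁻¹ = diag(1/α_i)`, then the iterates
`q(t+1) = f(Xq(t) + ṽ)` converge from any initial point to the unique
equilibrium `q* = f(Xq* + ṽ)`. -/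
theorem stmt_12 (n : ℕ) (hn : 1 ≤ n)
    (X : Matrix (Fin n) (Fin n) ℝ) (hXsym : X.IsSymm) (hXpd : X.PosDef)
    (vtil : Fin n → ℝ)
    (qmin qmax : Fin n → ℝ) (hmin : ∀ i, qmin i ≤ 0) (hmax : ∀ i, 0 ≤ qmax i)
    (α : Fin n → ℝ) (hα : ∀ i, 0 < α i)
    (f : Fin n → ℝ → ℝ)
    (hf_anti : ∀ i, Antitone (f i))
    (hf_lip : ∀ i, ∀ a b : ℝ, |f i a - f i b| ≤ α i * |a - b|)
    (hf_range : ∀ i x, f i x ∈ Set.Icc (qmin i) (qmax i))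
    (hC1 : ((Matrix.diagonal fun i => 1 / α i) - X).PosDef) :
    ∃ qstar : Fin n → ℝ,
      (∀ i, qstar i = f i ((X.mulVec qstar + vtil) i)) ∧
      (∀ p : Fin n → ℝ, (∀ i, p i = f i ((X.mulVec p + vtil) i)) → p = qstar) ∧
      (∀ q : ℕ → Fin n → ℝ,
        (∀ t, ∀ i, q (t+1) i = f i ((X.mulVec (q t) + vtil) i)) →
        Filter.Tendsto q Filter.atTop (nhds qstar)) := by
  obtain ⟨c, hc0, hc1, h⟩ := aux_main n hn X hXsym hXpd α hα hC1
  set F : (Fin n → ℝ) → Fin n → ℝ := fun q i => f i ((X.mulVec q + vtil) i) with hF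
  have hV : ∀ p q : Fin n → ℝ, ∑ i, (F p i - F q i) ^ 2 / α i ≤ c * ∑ i, (p i - q i) ^ 2 / α i := by
    intro p q
    refine le_trans (Finset.sum_le_sum fun i _ => ?_) (h (p - q))
    have h1 := hf_lip i ((X.mulVec p + vtil) i) ((X.mulVec q + vtil) i)
    have h2 : (X.mulVec p + vtil) i - (X.mulVec q + vtil) i = (X *ᵥ (p - q)) i := by
      simp [mulVec_sub]
    rw [h2] at h1
    have h3 := pow_le_pow_left₀ (abs_nonneg _) h1 2
    rw [sq_abs, mul_pow, sq_abs] at h3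
    rw [div_le_iff₀ (hα i)]
    exact h3.trans (le_of_eq (by ring))
  have hsq : ∀ i, 0 < √(α i) := fun i => Real.sqrt_pos.2 (hα i)
  let T : (Fin n → ℝ) → EuclideanSpace ℝ (Fin n) := fun q => WithLp.toLp 2 fun i => q i / √(α i)
  let S : EuclideanSpace ℝ (Fin n) → (Fin n → ℝ) := fun z i => √(α i) * z i
  have hST : ∀ q, S (T q) = q := by
    intro q; ext i
    have := (hsq i).ne'
    simp only [S, T]; field_simp
  have hTS : ∀ z, T (S z) = z := by
    intro z; ext i
    have := (hsq i).ne'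
    simp only [S, T]; field_simp
  have hdist : ∀ p q, dist (T p) (T q) ^ 2 = ∑ i, (p i - q i) ^ 2 / α i := by
    intro p q
    rw [dist_eq_norm, EuclideanSpace.norm_sq_eq]
    refine Finset.sum_congr rfl fun i _ => ?_
    simp only [T, PiLp.sub_apply, Real.norm_eq_abs, sq_abs]
    rw [← sub_div, div_pow, Real.sq_sqrt (hα i).le]
  have hG : ContractingWith (Real.toNNReal √c) (fun z => T (F (S z))) := by
    constructor
    · rw [Real.toNNReal_lt_one]
      rw [Real.sqrt_lt' one_pos]; simpa using hc1
    · refine LipschitzWith.of_dist_le_mul fun y z => ?_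
      rw [Real.coe_toNNReal _ (Real.sqrt_nonneg _)]
      refine le_of_sq_le_sq ?_ (by positivity)
      rw [mul_pow, Real.sq_sqrt hc0, hdist]
      conv_rhs => rw [← hTS y, ← hTS z, hdist]
      exact hV _ _
  have hfix := hG.fixedPoint_isFixedPt
  have hfix' : F (S (ContractingWith.fixedPoint _ hG)) = S (ContractingWith.fixedPoint _ hG) := by
    have := congrArg S hfix.eq
    rwa [hST] at this
  refine ⟨S (ContractingWith.fixedPoint _ hG), fun i => (congrFun hfix' i).symm, fun p hp => ?_, fun q hq => ?_⟩
  · have hp' : F p = p := (funext hp).symm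
    have : T p = ContractingWith.fixedPoint _ hG := by
      apply hG.fixedPoint_unique
      change T (F (S (T p))) = T p
      rw [hST, hp']
    rw [← this, hST]
  · have hq' : ∀ t, q (t+1) = F (q t) := fun t => funext (hq t)
    have hit : ∀ t, q t = S ((fun z => T (F (S z)))^[t] (T (q 0))) := by
      intro t
      induction t with
      | zero => simp [hST]
      | succ t ih => rw [Function.iterate_succ_apply', hST, hq', ih]
    have hcS : Continuous S := by
      simp only [S]; fun_prop
    rw [show q = _ from funext hit]
    exact (hcS.tendsto _).comp (hG.tendsto_iterate_fixedPoint (T (q 0)))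
end

section
/- Let T be a finite tree with vertex set {0, 1, …, n} (n ≥ 1), let x assign a strictly positive real weight x_e to each edge e of T, and for each i ∈ {1, …, n} let P_i denote the set of edges on the unique path in T from vertex 0 to vertex i. Define the n×n real matrix X by X_ij = Σ_{e ∈ P_i ∩ P_j} x_e. Then X is symmetric positive definite. -/
open Matrix

theorem aux_13 (n : ℕ)
    (G : SimpleGraph (Fin (n+1))) (hG : G.IsTree)
    (x : Sym2 (Fin (n+1)) → ℝ) (hx : ∀ e ∈ G.edgeSet, 0 < x e)
    (p : (i : Fin (n+1)) → G.Walk 0 i) (hp : ∀ i, (p i).IsPath)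
    (v : Fin n → ℝ)
    (hv : ∀ e ∈ G.edgeSet, ∑ i, (if e ∈ (p i.succ).edges then v i else 0) = 0) : v = 0 := by
  by_contra hne
  obtain ⟨i0, hi0⟩ := Function.ne_iff.mp hne
  obtain ⟨i, hi, hmax⟩ := Finset.exists_max_image
    (Finset.univ.filter fun i => v i ≠ 0) (fun i => (p i.succ).length) ⟨i0, by simpa using hi0⟩
  have hi' : v i ≠ 0 := by simpa using hi
  have hnil : ¬ (p i.succ).Nil := SimpleGraph.Walk.not_nil_of_ne (Fin.succ_ne_zero i).symm
  have he := (p i.succ).mk_penultimate_end_mem_edges hnil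
  have h := hv _ ((p i.succ).edges_subset_edgeSet he)
  rw [Finset.sum_eq_single i] at h
  · rw [if_pos he] at h
    exact hi' h
  · intro j _ hji
    split_ifs with hj
    · by_contra hvj
      have hlen := hmax j (by simpa using hvj)
      have hs : i.succ ∈ (p j.succ).support := (p j.succ).snd_mem_support_of_mem_edges hj
      have h1 : (p j.succ).takeUntil _ hs = p i.succ := by
        have := hG.2.path_unique ⟨_, (hp j.succ).takeUntil hs⟩ ⟨_, hp i.succ⟩
        exact congrArg Subtype.val this
      have h2 := congrArg SimpleGraph.Walk.length ((p j.succ).take_spec hs)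
      rw [SimpleGraph.Walk.length_append, h1] at h2
      have h3 : ((p j.succ).dropUntil _ hs).length = 0 := by
        omega
      exact hji (Fin.succ_injective _ (SimpleGraph.Walk.eq_of_length_eq_zero h3)).symm
    · rfl
  · simp

/-- The reactance matrix of a radial network is symmetric positive definite:
for a tree on vertices `{0, 1, …, n}` with strictly positive edge weights,
the matrix `X_ij = Σ_{e ∈ P_i ∩ P_j} x_e` (sum of weights of edges common to
the root-to-`i` and root-to-`j` paths) is symmetric positive definite. -/
theorem stmt_13 (n : ℕ) (hn : 1 ≤ n)
    (G : SimpleGraph (Fin (n+1))) (hG : G.IsTree)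
    (x : Sym2 (Fin (n+1)) → ℝ) (hx : ∀ e ∈ G.edgeSet, 0 < x e)
    (p : (i : Fin (n+1)) → G.Walk 0 i) (hp : ∀ i, (p i).IsPath)
    (X : Matrix (Fin n) (Fin n) ℝ)
    (hX : ∀ i j, X i j
      = ∑ e ∈ (p i.succ).edges.toFinset ∩ (p j.succ).edges.toFinset, x e) :
    X.IsSymm ∧ X.PosDef := by
  refine ⟨Matrix.IsSymm.ext fun i j => by rw [hX, hX, Finset.inter_comm], ?_⟩
  let B : Matrix (Sym2 (Fin (n+1))) (Fin n) ℝ :=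
    Matrix.of fun e i => if e ∈ (p i.succ).edges then √(x e) else 0
  have hB : X = Bᴴ * B := by
    ext i j
    rw [hX, Matrix.mul_apply, ← Finset.sum_subset (Finset.subset_univ
      ((p i.succ).edges.toFinset ∩ (p j.succ).edges.toFinset))]
    · refine Finset.sum_congr rfl fun e he => ?_
      simp only [Finset.mem_inter, List.mem_toFinset] at he
      have := hx e ((p i.succ).edges_subset_edgeSet he.1)
      simp [B, he.1, he.2, Real.mul_self_sqrt this.le]
    · intro e _ he
      simp only [Finset.mem_inter, List.mem_toFinset] at he
      simp only [B, Matrix.conjTranspose_apply, Matrix.of_apply, star_trivial]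
      split_ifs <;> simp_all
  rw [hB]
  refine Matrix.PosDef.conjTranspose_mul_self B ?_
  refine (injective_iff_map_eq_zero B.mulVecLin).mpr fun v hv => ?_
  refine aux_13 n G hG x hx p hp v fun e he => ?_
  have h := congrFun hv e
  have h2 : √(x e) * ∑ i, (if e ∈ (p i.succ).edges then v i else 0) = 0 := by
    refine Eq.trans ?_ h
    rw [Finset.mul_sum]
    simp [B, Matrix.mulVec, dotProduct]
  exact (mul_eq_zero.mp h2).resolve_left (Real.sqrt_pos.mpr (hx e he)).ne'
end

section
/- Let g : ℝ → ℝ be a strictly decreasing α-Lipschitz bijection for some α > 0, and define C(q) = −∫₀^q g⁻¹(s) ds. Then C is convex, differentiable with C′(q) = −g⁻¹(q), and (1/α)-strongly convex: for all a, b ∈ ℝ, C(b) ≥ C(a) + C′(a)(b − a) + (1/(2α))(b − a)². -/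
/-- The reverse-engineered cost `C(q) = −∫₀^q g⁻¹(s) ds` of a strictly
decreasing `α`-Lipschitz bijective control function `g` is convex,
differentiable with `C′(q) = −g⁻¹(q)`, and `(1/α)`-strongly convex. -/
theorem stmt_14 (g ginv : ℝ → ℝ) (α : ℝ) (hα : 0 < α)
    (hg_anti : StrictAnti g) (hg_bij : Function.Bijective g)
    (hg_lip : ∀ a b : ℝ, |g a - g b| ≤ α * |a - b|)
    (hginv : Function.LeftInverse ginv g ∧ Function.RightInverse ginv g)
    (C : ℝ → ℝ) (hC : ∀ q, C q = -∫ s in (0:ℝ)..q, ginv s) :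
    ConvexOn ℝ Set.univ C ∧
    (∀ q, HasDerivAt C (-(ginv q)) q) ∧
    (∀ a b : ℝ, C a + (-(ginv a)) * (b - a) + (1/(2*α)) * (b - a)^2 ≤ C b) := by
  have key : ∀ x y : ℝ, x ≤ y → (y - x) / α ≤ ginv x - ginv y := by
    intro x y hxy
    have hle : ginv y ≤ ginv x := by
      by_contra! h
      have := hg_anti h
      rw [hginv.2, hginv.2] at this
      linarith
    have h := hg_lip (ginv y) (ginv x)
    rw [hginv.2, hginv.2, abs_of_nonneg (by linarith), abs_of_nonpos (by linarith)] at h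
    rw [div_le_iff₀ hα]
    linarith
  have hmono : Monotone (fun x => -ginv x) := by
    intro x y hxy
    have h1 := key x y hxy
    have h2 : 0 ≤ (y - x) / α := div_nonneg (by linarith) hα.le
    show -ginv x ≤ -ginv y
    linarith
  have hcont : Continuous ginv := by
    have h : Continuous (fun x => -ginv x) := by
      apply hmono.continuous_of_surjective
      intro y
      exact ⟨g (-y), by simp [hginv.1 (-y)]⟩
    exact continuous_neg_iff.1 h
  have hder : ∀ q, HasDerivAt C (-(ginv q)) q := by
    intro q
    have hCe : C = fun q => -∫ s in (0:ℝ)..q, ginv s := funext hC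
    rw [hCe]
    exact (hcont.integral_hasStrictDerivAt 0 q).hasDerivAt.neg
  have hF : ∀ q, HasDerivAt (fun x => C x - x^2 / (2*α)) (-(ginv q) - q / α) q := by
    intro q
    have h2 := ((hasDerivAt_id q).pow 2).div_const (2*α)
    have h3 := (hder q).sub h2
    have h4 : q / α = ((2:ℕ) * (id q)^(2-1) * 1) / (2*α) := by
      simp
      field_simp
    rw [h4]
    exact h3
  refine ⟨?_, hder, ?_⟩
  · apply Monotone.convexOn_univ_of_deriv (fun q => (hder q).differentiableAt)
    have : deriv C = fun x => -ginv x := funext fun q => (hder q).deriv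
    rw [this]
    exact hmono
  · intro a b
    have hc : Continuous (fun x => C x - x^2 / (2*α)) :=
      continuous_iff_continuousAt.2 fun q => (hF q).continuousAt
    have hid : (1/(2*α)) * (b - a)^2 = b^2/(2*α) - a^2/(2*α) - (a/α) * (b-a) := by
      field_simp
      ring
    rw [hid]
    rcases lt_trichotomy a b with h | h | h
    · obtain ⟨c, hcm, hs⟩ := exists_hasDerivAt_eq_slope _ _ h hc.continuousOn (fun x _ => hF x)
      rw [eq_div_iff (by linarith)] at hs
      have hk := key a c hcm.1.le
      rw [sub_div] at hk
      have := mul_le_mul_of_nonneg_right (show -ginv a - a/α ≤ -ginv c - c/α by linarith)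
        (show 0 ≤ b - a by linarith)
      linarith
    · subst h; simp
    · obtain ⟨c, hcm, hs⟩ := exists_hasDerivAt_eq_slope _ _ h hc.continuousOn (fun x _ => hF x)
      rw [eq_div_iff (by linarith)] at hs
      have hk := key c a hcm.2.le
      rw [sub_div] at hk
      have := mul_le_mul_of_nonneg_right (show -ginv c - c/α ≤ -ginv a - a/α by linarith)
        (show 0 ≤ a - b by linarith)
      linarith
end
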